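/- arXiv:1206.3510 — 4 statements merged into one kernel-verified Lean document; each statement's English description precedes it below -/
import Mathlib

section
/- For every positive integer n and every 0 ≤ k ≤ ⌊(n-1)/2⌋, the polynomial a_{n,k}(p,q) = Σ_{σ ∈ S_{n,k}} p^{res σ} q^{les σ} is divisible by (p+q)^k in ℤ[p,q]. -/
open Finset MvPolynomial

/-- The value `σ(i)` for a permutation of `{1,…,n}` encoded as `Equiv.Perm (Fin n)`,
with the convention `σ(i) = 0` for `i = 0` and `i = n+1` (indeed for all `i ∉ [n]`). -/
def pval (n : ℕ) (σ : Equiv.Perm (Fin n)) (i : ℕ) : ℕ :=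
  if h : 1 ≤ i ∧ i ≤ n then ((σ ⟨i - 1, by omega⟩ : Fin n) : ℕ) + 1 else 0

/-- Number of inversions: pairs `1 ≤ i < j ≤ n` with `σ(i) > σ(j)`. -/
def inv (n : ℕ) (σ : Equiv.Perm (Fin n)) : ℕ :=
  ((Finset.Icc 1 n ×ˢ Finset.Icc 1 n).filter
    (fun p => p.1 < p.2 ∧ pval n σ p.2 < pval n σ p.1)).card

/-- Number of excedances: indices `i ∈ [n]` with `i < σ(i)`. -/
def exc (n : ℕ) (σ : Equiv.Perm (Fin n)) : ℕ :=
  ((Finset.Icc 1 n).filter (fun i => i < pval n σ i)).card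

/-- Number of drops: indices `i ∈ [n]` with `i > σ(i)`. -/
def drp (n : ℕ) (σ : Equiv.Perm (Fin n)) : ℕ :=
  ((Finset.Icc 1 n).filter (fun i => pval n σ i < i)).card

/-- Number of descents: indices `1 ≤ i < n` with `σ(i) > σ(i+1)`. -/
def des (n : ℕ) (σ : Equiv.Perm (Fin n)) : ℕ :=
  ((Finset.Icc 1 (n - 1)).filter (fun i => pval n σ (i + 1) < pval n σ i)).card

/-- `les σ`: number of pairs `2 ≤ i < j ≤ n` with `σ(i-1) > σ(j) > σ(i)`. -/
def les (n : ℕ) (σ : Equiv.Perm (Fin n)) : ℕ :=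
  ((Finset.Icc 2 n ×ˢ Finset.Icc 2 n).filter
    (fun p => p.1 < p.2 ∧ pval n σ p.2 < pval n σ (p.1 - 1) ∧
      pval n σ p.1 < pval n σ p.2)).card

/-- `res σ`: number of pairs `1 ≤ i < j ≤ n-1` with `σ(j+1) > σ(i) > σ(j)`. -/
def res (n : ℕ) (σ : Equiv.Perm (Fin n)) : ℕ :=
  ((Finset.Icc 1 (n - 1) ×ˢ Finset.Icc 1 (n - 1)).filter
    (fun p => p.1 < p.2 ∧ pval n σ p.2 < pval n σ p.1 ∧
      pval n σ p.1 < pval n σ (p.2 + 1))).card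

/-- `ress σ`: number of pairs `1 ≤ i < j ≤ n-1` with `σ(j+1) < σ(i) < σ(j)`. -/
def ress (n : ℕ) (σ : Equiv.Perm (Fin n)) : ℕ :=
  ((Finset.Icc 1 (n - 1) ×ˢ Finset.Icc 1 (n - 1)).filter
    (fun p => p.1 < p.2 ∧ pval n σ (p.2 + 1) < pval n σ p.1 ∧
      pval n σ p.1 < pval n σ p.2)).card

/-- Crossing number: pairs `(i,j) ∈ [n]×[n]` with `i < j ≤ σ(i) < σ(j)` or
`i > j > σ(i) > σ(j)`. -/
def cros (n : ℕ) (σ : Equiv.Perm (Fin n)) : ℕ :=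
  ((Finset.Icc 1 n ×ˢ Finset.Icc 1 n).filter
    (fun p => (p.1 < p.2 ∧ p.2 ≤ pval n σ p.1 ∧ pval n σ p.1 < pval n σ p.2) ∨
      (p.2 < p.1 ∧ pval n σ p.1 < p.2 ∧ pval n σ p.2 < pval n σ p.1))).card

/-- Nesting number: pairs `(i,j) ∈ [n]×[n]` with `i < j ≤ σ(j) < σ(i)` or
`i > j > σ(j) > σ(i)`. -/
def nest (n : ℕ) (σ : Equiv.Perm (Fin n)) : ℕ :=
  ((Finset.Icc 1 n ×ˢ Finset.Icc 1 n).filter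
    (fun p => (p.1 < p.2 ∧ p.2 ≤ pval n σ p.2 ∧ pval n σ p.2 < pval n σ p.1) ∨
      (p.2 < p.1 ∧ pval n σ p.2 < p.2 ∧ pval n σ p.1 < pval n σ p.2))).card

/-- Number of valleys: `i ∈ [n]` with `σ(i-1) > σ(i)` and `σ(i) < σ(i+1)`
(convention `σ(0) = σ(n+1) = 0`). -/
def valleys (n : ℕ) (σ : Equiv.Perm (Fin n)) : ℕ :=
  ((Finset.Icc 1 n).filter
    (fun i => pval n σ i < pval n σ (i - 1) ∧ pval n σ i < pval n σ (i + 1))).card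

/-- Number of double descents: `i ∈ [n]` with `σ(i-1) > σ(i)` and `σ(i) > σ(i+1)`
(convention `σ(0) = σ(n+1) = 0`). -/
def ddes (n : ℕ) (σ : Equiv.Perm (Fin n)) : ℕ :=
  ((Finset.Icc 1 n).filter
    (fun i => pval n σ i < pval n σ (i - 1) ∧ pval n σ (i + 1) < pval n σ i)).card

/-- `S_{n,k}`: permutations of `[n]` with exactly `k` valleys and no double descents. -/
def Snk (n k : ℕ) : Finset (Equiv.Perm (Fin n)) :=
  Finset.univ.filter (fun σ => valleys n σ = k ∧ ddes n σ = 0)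


namespace PaddedWord

/-- The number of ascents `a, b` of a word, at consecutive positions, with `a < x < b`. -/
def ascAt (x : ℕ) : List ℕ → ℕ
  | a :: b :: l => (if a < x ∧ x < b then 1 else 0) + ascAt x (b :: l)
  | _ => 0

/-- The number of pairs of a letter `x` and a later ascent `a, b` with `a < x < b`. -/
def resW : List ℕ → ℕ
  | [] => 0
  | a :: l => ascAt a l + resW l

/-- The number of interior positive letters smaller than both neighbours. -/
def valW : List ℕ → ℕ
  | a :: b :: c :: l => (if 0 < b ∧ b < a ∧ b < c then 1 else 0) + valW (b :: c :: l)
  | _ => 0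

/-- The number of interior letters at which the word descends twice. -/
def ddW : List ℕ → ℕ
  | a :: b :: c :: l => (if b < a ∧ c < b then 1 else 0) + ddW (b :: c :: l)
  | _ => 0

/-- The words of `W`, each preceded by `0`, concatenated. -/
def pre (W : List (List ℕ)) : List ℕ := W.flatMap (0 :: ·)

/-- The words of `W`, separated and enclosed by zeros, concatenated. -/
def pad (W : List (List ℕ)) : List ℕ := pre W ++ [0]

lemma ascAt_zero (l : List ℕ) : ascAt 0 l = 0 := by
  induction l with
  | nil => rfl
  | cons a l ih => cases l <;> simp_all [ascAt]

lemma ascAt_append (x c : ℕ) (X Y : List ℕ) :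
    ascAt x (X ++ c :: Y) = ascAt x (X ++ [c]) + ascAt x (c :: Y) := by
  induction X with
  | nil => simp [ascAt]
  | cons a X ih => cases X <;> simp_all [ascAt]; omega

lemma ascAt_append_singleton {x c : ℕ} (h : c ≤ x) (X : List ℕ) :
    ascAt x (X ++ [c]) = ascAt x X := by
  induction X with
  | nil => simp [ascAt]
  | cons a X ih => cases X <;> simp_all [ascAt]

lemma ascAt_cons_of_lt {x a b : ℕ} (ha : a < x) (hb : b < x) (Y : List ℕ) :
    ascAt x (a :: Y) = ascAt x (b :: Y) := by
  cases Y <;> simp [ascAt, ha, hb]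

lemma ascAt_replace {x v : ℕ} (hx : x = 0 ∨ v < x) (X Y s : List ℕ)
    (hs : s = [0, v, 0] ∨ s = [0, v] ∨ s = [v, 0] ∨ s = [v]) :
    ascAt x (X ++ s ++ Y) = ascAt x (X ++ 0 :: Y) := by
  rcases hx with rfl | hx
  · simp [ascAt_zero]
  have h0 : 0 < x := by omega
  have hv := ascAt_cons_of_lt hx h0 Y
  have e1 := ascAt_append_singleton hx.le X
  have e0 := ascAt_append_singleton h0.le X
  rcases hs with rfl | rfl | rfl | rfl <;>
    simp only [List.append_assoc, List.cons_append, List.nil_append] <;>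
    rw [ascAt_append, ascAt_append x 0 X Y] <;>
    simp [ascAt, hx.le, h0.le, hv, e0, e1, Nat.not_lt.2]

lemma resW_replace {v : ℕ} (X Y s₁ s₂ : List ℕ) (hX : ∀ x ∈ X, x = 0 ∨ v < x)
    (h₁ : s₁ = [] ∨ s₁ = [0]) (h₂ : s₂ = [] ∨ s₂ = [0]) :
    resW (X ++ s₁ ++ v :: (s₂ ++ Y)) = resW (X ++ 0 :: Y) + ascAt v (s₂ ++ Y) := by
  induction X with
  | nil =>
    rcases h₁ with rfl | rfl <;> rcases h₂ with rfl | rfl <;>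
      simp [resW, ascAt_zero] <;> omega
  | cons a X ih =>
    have hs : s₁ ++ v :: s₂ = [0, v, 0] ∨ s₁ ++ v :: s₂ = [0, v] ∨ s₁ ++ v :: s₂ = [v, 0] ∨
        s₁ ++ v :: s₂ = [v] := by
      rcases h₁ with rfl | rfl <;> rcases h₂ with rfl | rfl <;> simp
    have h := ascAt_replace (hX a (by simp)) X Y _ hs
    have ih := ih fun x hx => hX x (by simp [hx])
    simp only [List.append_assoc, List.cons_append, resW] at h ih ⊢
    omega

lemma ascAt_append_of_lt {v : ℕ} (w Y : List ℕ) (hw : ∀ x ∈ w, v < x) :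
    ascAt v (w ++ 0 :: Y) = ascAt v (0 :: Y) := by
  induction w with
  | nil => rfl
  | cons a w ih =>
    have ih := ih fun x hx => hw x (by simp [hx])
    have := hw a (by simp)
    cases w <;> simp_all [ascAt]; omega

lemma ascAt_append_pad {v : ℕ} (hv : 0 < v) (B : List (List ℕ)) :
    ∀ w : List ℕ, (∀ x ∈ w, v < x) → [] ∉ B → (∀ b ∈ B, ∀ x ∈ b, v < x) →
      ascAt v (w ++ pad B) = B.length := by
  induction B with
  | nil => intro w hw _ _; simpa [pad, pre, ascAt] using ascAt_append_of_lt w [] hw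
  | cons b B ih =>
    intro w hw hB hlt
    have e : pad (b :: B) = 0 :: (b ++ pad B) := by simp [pad, pre]
    have ih := ih b (hlt b (by simp)) (by simp_all) fun c hc => hlt c (by simp [hc])
    rw [e, ascAt_append_of_lt w _ hw]
    cases b with
    | nil => simp at hB
    | cons c b =>
      have := hlt (c :: b) (by simp) c (by simp)
      simp only [List.cons_append] at ih ⊢
      simp [ascAt, hv, this, ih]; omega

lemma valW_replace_isolated {v : ℕ} (X Y : List ℕ) :
    valW (X ++ 0 :: v :: 0 :: Y) = valW (X ++ 0 :: Y) := by
  induction X with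
  | nil => cases Y <;> simp [valW]
  | cons a X ih => rcases X with _ | ⟨b, _ | ⟨c, X⟩⟩ <;> cases Y <;> simp_all [valW]

lemma ddW_replace_isolated {v : ℕ} (X Y : List ℕ) :
    ddW (X ++ 0 :: v :: 0 :: Y) = ddW (X ++ 0 :: Y) := by
  induction X with
  | nil => cases Y <;> simp [ddW]
  | cons a X ih => rcases X with _ | ⟨b, _ | ⟨c, X⟩⟩ <;> cases Y <;> simp_all [ddW]

lemma valW_replace_initial {v r : ℕ} (hr : v < r) (X Y : List ℕ) :
    valW (X ++ 0 :: v :: r :: Y) = valW (X ++ 0 :: r :: Y) := by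
  induction X with
  | nil => cases Y <;> simp [valW, hr.le]
  | cons a X ih => rcases X with _ | ⟨b, _ | ⟨c, X⟩⟩ <;> cases Y <;> simp_all [valW]

lemma ddW_replace_initial {v r : ℕ} (hr : v < r) (X Y : List ℕ) :
    ddW (X ++ 0 :: v :: r :: Y) = ddW (X ++ 0 :: r :: Y) := by
  induction X with
  | nil => cases Y <;> simp [ddW, hr.le]
  | cons a X ih => rcases X with _ | ⟨b, _ | ⟨c, X⟩⟩ <;> cases Y <;> simp_all [ddW]

lemma valW_replace_interior {v l r : ℕ} (hv : 0 < v) (hl : v < l) (hr : v < r) (X Y : List ℕ) :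
    valW (X ++ l :: v :: r :: Y) = valW (X ++ l :: 0 :: r :: Y) + 1 := by
  induction X with
  | nil => cases Y <;> simp [valW, hv, hl, hr, hr.not_gt]; omega
  | cons a X ih =>
    rcases X with _ | ⟨b, _ | ⟨c, X⟩⟩ <;> cases Y <;> simp_all [valW, hl.le] <;> omega

lemma ddW_replace_interior {v l r : ℕ} (hl : v < l) (hr : v < r) (X Y : List ℕ) :
    ddW (X ++ l :: v :: r :: Y) = ddW (X ++ l :: 0 :: r :: Y) := by
  induction X with
  | nil => cases Y <;> simp [ddW, hr.not_gt]
  | cons a X ih =>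
    have : 0 < l := by omega
    rcases X with _ | ⟨b, _ | ⟨c, X⟩⟩ <;> cases Y <;> simp_all [ddW, hr.le]

lemma ddW_replace_final {v l : ℕ} (hv : 0 < v) (hl : v < l) (X Y : List ℕ) :
    0 < ddW (X ++ l :: v :: 0 :: Y) := by
  induction X with
  | nil => cases Y <;> simp [ddW, hv, hl]
  | cons a X ih =>
    rcases X with _ | ⟨b, _ | ⟨c, X⟩⟩ <;> cases Y <;> simp_all [ddW]

/-- The list with the single word `u`, or the empty list if `u` is empty. -/
def opt (u : List ℕ) : List (List ℕ) := if u = [] then [] else [u]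

@[simp] lemma opt_nil : opt [] = [] := rfl

@[simp] lemma opt_cons (a : ℕ) (u : List ℕ) : opt (a :: u) = [a :: u] := rfl

@[simp] lemma flatten_opt (u : List ℕ) : (opt u).flatten = u := by cases u <;> simp

lemma nil_notMem_opt (u : List ℕ) : [] ∉ opt u := by cases u <;> simp

/-- The words of `A`, then those of `u` and `w` that are nonempty, then the words of `B`. -/
def split (A : List (List ℕ)) (u w : List ℕ) (B : List (List ℕ)) : List (List ℕ) :=
  A ++ (opt u ++ (opt w ++ B))

/-- The words of `A`, then `u` and `w` joined by the letter `v`, then the words of `B`. -/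
def merge (v : ℕ) (A : List (List ℕ)) (u w : List ℕ) (B : List (List ℕ)) : List (List ℕ) :=
  A ++ (u ++ v :: w) :: B

/-- Reversal of a sequence of words: both the words and their order are reversed. -/
def mirror (W : List (List ℕ)) : List (List ℕ) := (W.map List.reverse).reverse

lemma pad_cons (w : List ℕ) (W : List (List ℕ)) : pad (w :: W) = 0 :: (w ++ pad W) := by
  simp [pad, pre]

lemma pad_append (A B : List (List ℕ)) : pad (A ++ B) = pre A ++ pad B := by
  simp [pad, pre]

lemma exists_pad_eq (B : List (List ℕ)) : ∃ R, pad B = 0 :: R := by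
  cases B with
  | nil => exact ⟨[], rfl⟩
  | cons b B => exact ⟨_, pad_cons b B⟩

lemma pad_mirror (W : List (List ℕ)) : pad (mirror W) = (pad W).reverse := by
  induction W with
  | nil => rfl
  | cons w W ih =>
    have e : mirror (w :: W) = mirror W ++ [w.reverse] := by simp [mirror]
    have e' : pre (mirror W) ++ [0] = (pad W).reverse := ih
    rw [e, pad_append, pad_cons, pad_cons, List.reverse_cons, List.reverse_append, ← e']
    simp [pad, pre]

lemma opt_reverse (u : List ℕ) : opt u.reverse = (opt u).map List.reverse := by
  cases u <;> simp [opt]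

lemma mirror_split (A : List (List ℕ)) (u w : List ℕ) (B : List (List ℕ)) :
    mirror (split A u w B) = split (mirror B) w.reverse u.reverse (mirror A) := by
  cases u <;> cases w <;> simp [mirror, split, opt]

lemma mirror_merge (v : ℕ) (A : List (List ℕ)) (u w : List ℕ) (B : List (List ℕ)) :
    mirror (merge v A u w B) = merge v (mirror B) w.reverse u.reverse (mirror A) := by
  simp [mirror, merge]

lemma eq_zero_or_lt_of_mem_pre {v : ℕ} {A : List (List ℕ)} (hA : ∀ a ∈ A, ∀ x ∈ a, v < x) :
    ∀ x ∈ pre A, x = 0 ∨ v < x := by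
  intro x hx
  simp only [pre, List.mem_flatMap, List.mem_cons] at hx
  obtain ⟨a, ha, rfl | hx⟩ := hx
  · exact .inl rfl
  · exact .inr (hA a ha x hx)

section Insertion

variable {v : ℕ} {A : List (List ℕ)} {u w : List ℕ} {B : List (List ℕ)}

lemma resW_merge (hv : 0 < v) (hlt : ∀ a ∈ split A u w B, ∀ x ∈ a, v < x)
    (hB : [] ∉ B) :
    resW (pad (merge v A u w B)) = resW (pad (split A u w B)) + B.length := by
  obtain ⟨R, hR⟩ := exists_pad_eq B
  have hA := eq_zero_or_lt_of_mem_pre fun a (ha : a ∈ A) => hlt a (by simp [split, ha])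
  have hw : ∀ x ∈ w, v < x := by
    cases w with
    | nil => simp
    | cons c w => exact hlt _ (by simp [split])
  have hu : ∀ x ∈ u, v < x := by
    cases u with
    | nil => simp
    | cons c w => exact hlt _ (by simp [split])
  have key := ascAt_append_pad hv B w hw hB fun b hb => hlt b (by simp [split, hb])
  have hX : ∀ x ∈ pre A ++ 0 :: u, x = 0 ∨ v < x := by
    simp only [List.mem_append, List.mem_cons]
    rintro x (h | rfl | h)
    exacts [hA x h, .inl rfl, .inr (hu x h)]
  rw [← key]
  rcases u with _ | ⟨a, u⟩ <;> rcases w with _ | ⟨b, w⟩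
  · have := resW_replace (pre A) R [0] [0] hA (.inr rfl) (.inr rfl)
    simpa [merge, split, pad_append, pad_cons, hR] using this
  · have := resW_replace (pre A) (b :: w ++ pad B) [0] [] hA (.inr rfl) (.inl rfl)
    simpa [merge, split, pad_append, pad_cons] using this
  · have := resW_replace (pre A ++ 0 :: a :: u) R [] [0] hX (.inl rfl) (.inr rfl)
    simpa [merge, split, pad_append, pad_cons, hR] using this
  · have := resW_replace (pre A ++ 0 :: a :: u) (b :: w ++ pad B) [] [] hX (.inl rfl) (.inl rfl)
    simpa [merge, split, pad_append, pad_cons] using this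

lemma resW_reverse_merge (hv : 0 < v) (hlt : ∀ a ∈ split A u w B, ∀ x ∈ a, v < x)
    (hA : [] ∉ A) :
    resW (pad (merge v A u w B)).reverse = resW (pad (split A u w B)).reverse + A.length := by
  rw [← pad_mirror, ← pad_mirror, mirror_merge, mirror_split, resW_merge hv]
  · simp [mirror]
  · rw [← mirror_split]
    intro a ha x hx
    exact hlt a.reverse (by simpa [mirror] using ha) x (by simpa using hx)
  · simpa [mirror] using hA

lemma ddW_merge (hlt : ∀ a ∈ split A u w B, ∀ x ∈ a, v < x) (huw : u ≠ [] → w ≠ []) :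
    ddW (pad (merge v A u w B)) = ddW (pad (split A u w B)) := by
  obtain ⟨R, hR⟩ := exists_pad_eq B
  rcases w with _ | ⟨r, w⟩
  · obtain rfl : u = [] := by_contra fun h => huw h rfl
    simpa [merge, split, pad_append, pad_cons, hR] using ddW_replace_isolated (pre A) R
  have hr : v < r := hlt (r :: w) (by simp [split]) r (by simp)
  rcases u.eq_nil_or_concat with rfl | ⟨u, l, rfl⟩
  · simpa [merge, split, pad_append, pad_cons] using ddW_replace_initial hr (pre A) (w ++ pad B)
  · have hl : v < l := hlt (u ++ [l]) (by simp [split, opt]) l (by simp)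
    simpa [merge, split, opt, pad_append, pad_cons] using
      ddW_replace_interior hl hr (pre A ++ 0 :: u) (w ++ pad B)

lemma ddW_merge_pos (hv : 0 < v) (hlt : ∀ a ∈ split A u [] B, ∀ x ∈ a, v < x) (hu : u ≠ []) :
    0 < ddW (pad (merge v A u [] B)) := by
  obtain ⟨R, hR⟩ := exists_pad_eq B
  rcases u.eq_nil_or_concat with rfl | ⟨u, l, rfl⟩
  · simp at hu
  · have hl : v < l := hlt (u ++ [l]) (by simp [split, opt]) l (by simp)
    simpa [merge, pad_append, pad_cons, hR] using ddW_replace_final hv hl (pre A ++ 0 :: u) R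

lemma valW_merge (hv : 0 < v) (hlt : ∀ a ∈ split A u w B, ∀ x ∈ a, v < x)
    (huw : u ≠ [] → w ≠ []) :
    valW (pad (merge v A u w B)) =
      valW (pad (split A u w B)) + (!u.isEmpty && !w.isEmpty).toNat := by
  obtain ⟨R, hR⟩ := exists_pad_eq B
  rcases w with _ | ⟨r, w⟩
  · obtain rfl : u = [] := by_contra fun h => huw h rfl
    simpa [merge, split, pad_append, pad_cons, hR] using valW_replace_isolated (pre A) R
  have hr : v < r := hlt (r :: w) (by simp [split]) r (by simp)
  rcases u.eq_nil_or_concat with rfl | ⟨u, l, rfl⟩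
  · simpa [merge, split, pad_append, pad_cons] using valW_replace_initial hr (pre A) (w ++ pad B)
  · have hl : v < l := hlt (u ++ [l]) (by simp [split, opt]) l (by simp)
    have hu : (u ++ [l]).isEmpty = false := by simp
    simpa [merge, split, opt, pad_append, pad_cons, hu] using
      valW_replace_interior hv hl hr (pre A ++ 0 :: u) (w ++ pad B)

lemma flatten_merge_perm :
    (merge v A u w B).flatten.Perm (v :: (split A u w B).flatten) := by
  simp only [merge, split, List.flatten_append, List.flatten_cons, flatten_opt]
  rw [List.append_assoc, ← List.append_assoc, ← List.append_assoc A.flatten u]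
  exact List.perm_middle

lemma nil_notMem_split : [] ∉ split A u w B ↔ [] ∉ A ∧ [] ∉ B := by
  simp [split, nil_notMem_opt]

lemma nil_notMem_merge : [] ∉ merge v A u w B ↔ [] ∉ A ∧ [] ∉ B := by
  simp [merge]

lemma length_split : (split A u w B).length =
    A.length + B.length + (!u.isEmpty).toNat + (!w.isEmpty).toNat := by
  cases u <;> cases w <;> simp [split] <;> omega

lemma merge_inj {A' B' : List (List ℕ)} {u' w' : List ℕ} (h : v ∉ (split A u w B).flatten)
    (e : merge v A u w B = merge v A' u' w' B') : A = A' ∧ u = u' ∧ w = w' ∧ B = B' := by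
  simp only [split, List.flatten_append, flatten_opt, List.mem_append, not_or] at h
  obtain ⟨hA, hu, hw, hB⟩ := h
  have hx : ∀ C : List (List ℕ), v ∈ (C ++ (u' ++ v :: w') :: B').flatten := by simp
  unfold merge at e
  induction A generalizing A' with
  | nil =>
    cases A' with
    | nil =>
      simp only [List.nil_append, List.cons.injEq] at e
      have := (List.append_cons_inj_of_notMem hu hw).1 e.1
      exact ⟨rfl, this.1, this.2.2, e.2⟩
    | cons a A' =>
      simp only [List.nil_append, List.cons_append, List.cons.injEq] at e
      exact absurd (e.2 ▸ hx A') hB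
  | cons a A ih =>
    cases A' with
    | nil =>
      simp only [List.nil_append, List.cons_append, List.cons.injEq] at e
      simp [e.1] at hA
    | cons a' A' =>
      simp only [List.cons_append, List.cons.injEq] at e
      have hA' : v ∉ A.flatten := fun h => hA (List.flatten_cons ▸ List.mem_append_right a h)
      have := ih e.2 hA'
      exact ⟨by rw [e.1, this.1], this.2⟩

end Insertion

/-- A sequence of nonempty words without double descents using each of the letters
`t + 1, …, t + m` exactly once. -/
structure IsConfig (t m : ℕ) (W : List (List ℕ)) : Prop where
  perm : W.flatten.Perm (List.range' (t + 1) m)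
  nil_notMem : [] ∉ W
  ddW_eq : ddW (pad W) = 0

lemma IsConfig.lt {t m : ℕ} {W : List (List ℕ)} (h : IsConfig t m W) :
    ∀ a ∈ W, ∀ x ∈ a, t < x := by
  intro a ha x hx
  have := h.perm.mem_iff.1 (List.mem_flatten_of_mem ha hx)
  simp only [List.mem_range'_1] at this
  omega

lemma isConfig_merge_iff {t m : ℕ} {A : List (List ℕ)} {u w : List ℕ} {B : List (List ℕ)} :
    IsConfig t (m + 1) (merge (t + 1) A u w B) ↔
      (u ≠ [] → w ≠ []) ∧ IsConfig (t + 1) m (split A u w B) := by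
  have hp : (merge (t + 1) A u w B).flatten.Perm (List.range' (t + 1) (m + 1)) ↔
      (split A u w B).flatten.Perm (List.range' (t + 1 + 1) m) := by
    rw [List.range'_succ, flatten_merge_perm.congr_left, List.perm_cons]
  have hlt (h : (split A u w B).flatten.Perm (List.range' (t + 1 + 1) m)) :
      ∀ a ∈ split A u w B, ∀ x ∈ a, t + 1 < x := by
    intro a ha x hx
    have := h.mem_iff.1 (List.mem_flatten_of_mem ha hx)
    simp only [List.mem_range'_1] at this
    omega
  constructor
  · rintro ⟨h₁, h₂, h₃⟩
    have h₁ := hp.1 h₁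
    have huw : u ≠ [] → w ≠ [] := by
      rintro hu rfl
      exact (ddW_merge_pos t.succ_pos (hlt h₁) hu).ne' h₃
    exact ⟨huw, h₁, nil_notMem_split.2 (nil_notMem_merge.1 h₂), ddW_merge (hlt h₁) huw ▸ h₃⟩
  · rintro ⟨huw, h₁, h₂, h₃⟩
    exact ⟨hp.2 h₁, nil_notMem_merge.2 (nil_notMem_split.1 h₂), ddW_merge (hlt h₁) huw ▸ h₃⟩

lemma IsConfig.exists_merge {t m : ℕ} {W : List (List ℕ)} (h : IsConfig t (m + 1) W) :
    ∃ A u w B, W = merge (t + 1) A u w B := by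
  have : t + 1 ∈ W.flatten := h.perm.mem_iff.2 (by simp)
  obtain ⟨l, hl, hx⟩ := List.mem_flatten.1 this
  obtain ⟨A, B, rfl⟩ := List.append_of_mem hl
  obtain ⟨u, w, rfl⟩ := List.append_of_mem hx
  exact ⟨A, u, w, B, rfl⟩

/-- Insertion of the letter `v` after the first `g` words of `W`, joining `v` to the next word on its
left if `b.1` holds and to the next word on its right if `b.2` holds. -/
def ins (v : ℕ) (b : Bool × Bool) (g : ℕ) (W : List (List ℕ)) : List (List ℕ) :=
  let C := W.drop g
  let C' := if b.1 then C.tail else C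
  merge v (W.take g) (if b.1 then C.headD [] else []) (if b.2 then C'.headD [] else [])
    (if b.2 then C'.tail else C')

lemma ins_split (v : ℕ) (A : List (List ℕ)) (u w : List ℕ) (B : List (List ℕ)) :
    ins v (!u.isEmpty, !w.isEmpty) A.length (split A u w B) = merge v A u w B := by
  cases u <;> cases w <;> simp [ins, split, opt]

lemma exists_split {W : List (List ℕ)} (hW : [] ∉ W) {g h : ℕ} {b : Bool × Bool} (hg : g < h)
    (hl : W.length + 1 = h + b.1.toNat + b.2.toNat) :
    ∃ A u w B, A.length = g ∧ b = (!u.isEmpty, !w.isEmpty) ∧ W = split A u w B ∧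
      B.length = h - 1 - g := by
  have hC : [] ∉ W.drop g := fun h => hW (List.mem_of_mem_drop h)
  have hlC : (W.drop g).length = W.length - g := List.length_drop
  have hA : (W.take g).length = g := by
    rw [List.length_take]
    obtain ⟨_ | _, _ | _⟩ := b <;> simp at hl <;> omega
  have e := (List.take_append_drop g W).symm
  generalize W.drop g = C at *
  generalize W.take g = A at *
  obtain ⟨_ | _, _ | _⟩ := b
  · exact ⟨A, [], [], C, hA, rfl, by simp [split, e], by simp at hl; omega⟩
  · rcases C with _ | ⟨_ | ⟨r, w⟩, B⟩
    · simp at hl hlC; omega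
    · simp at hC
    · exact ⟨A, [], r :: w, B, hA, rfl, by simp [split, e], by simp at hl hlC; omega⟩
  · rcases C with _ | ⟨_ | ⟨r, w⟩, B⟩
    · simp at hl hlC; omega
    · simp at hC
    · exact ⟨A, r :: w, [], B, hA, rfl, by simp [split, e], by simp at hl hlC; omega⟩
  · rcases C with _ | ⟨_ | ⟨r, w⟩, C⟩
    · simp at hl hlC; omega
    · simp at hC
    rcases C with _ | ⟨_ | ⟨r', w'⟩, B⟩
    · simp at hl hlC; omega
    · simp at hC
    · exact ⟨A, r :: w, r' :: w', B, hA, rfl, by simp [split, e], by simp at hl hlC; omega⟩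

lemma isConfig_zero_iff {t : ℕ} {W : List (List ℕ)} : IsConfig t 0 W ↔ W = [] := by
  constructor
  · rintro ⟨h₁, h₂, -⟩
    rcases W with _ | ⟨_ | ⟨a, w⟩, W⟩
    · rfl
    · simp at h₂
    · simp at h₁
  · rintro rfl
    exact ⟨by simp, by simp, rfl⟩

lemma finite_isConfig (t m : ℕ) : {W | IsConfig t m W}.Finite := by
  induction m generalizing t with
  | zero => simp [isConfig_zero_iff]
  | succ m ih =>
    refine ((ih (t + 1)).biUnion fun W _ => ((Set.finite_Iic W.length).prod
      (Set.finite_univ (α := Bool × Bool))).image fun x => ins (t + 1) x.2 x.1 W).subset ?_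
    intro W' hW'
    obtain ⟨A, u, w, B, rfl⟩ := IsConfig.exists_merge hW'
    refine Set.mem_biUnion (isConfig_merge_iff.1 hW').2 ⟨(A.length, (!u.isEmpty, !w.isEmpty)),
      ⟨by simp [split], trivial⟩, ins_split ..⟩

/-- The finset of configurations on the letters `t + 1, …, t + m`. -/
noncomputable def configs (t m : ℕ) : Finset (List (List ℕ)) := (finite_isConfig t m).toFinset

lemma mem_configs {t m : ℕ} {W : List (List ℕ)} : W ∈ configs t m ↔ IsConfig t m W := by
  simp [configs]

variable {R : Type*} [CommRing R] (x y : R)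

/-- The monomial recording the two statistics of a sequence of words. -/
def weight (W : List (List ℕ)) : R := x ^ resW (pad W) * y ^ resW (pad W).reverse

/-- The total weight of the configurations with `h` words and `k` valleys. -/
noncomputable def configSum (t m h k : ℕ) : R :=
  ∑ W ∈ configs t m with W.length = h ∧ valW (pad W) = k, weight x y W

/-- The ways of inserting a smallest letter which do not create a double descent: as a new word,
at the start of a word, or between two words. -/
def kinds : Finset (Bool × Bool) := {(false, false), (false, true), (true, true)}

lemma mem_kinds (u w : List ℕ) : (!u.isEmpty, !w.isEmpty) ∈ kinds ↔ (u ≠ [] → w ≠ []) := by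
  cases u <;> cases w <;> simp [kinds]

lemma configSum_succ (t m h k : ℕ) :
    configSum x y t (m + 1) h k =
      ∑ b ∈ kinds, (∑ g ∈ range h, x ^ (h - 1 - g) * y ^ g) *
        ∑ W ∈ configs (t + 1) m with W.length + 1 = h + b.1.toNat + b.2.toNat ∧
          valW (pad W) + (b.1 && b.2).toNat = k, weight x y W := by
  have e : ∑ b ∈ kinds, (∑ g ∈ range h, x ^ (h - 1 - g) * y ^ g) *
        ∑ W ∈ configs (t + 1) m with W.length + 1 = h + b.1.toNat + b.2.toNat ∧
          valW (pad W) + (b.1 && b.2).toNat = k, weight x y W =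
      ∑ z ∈ ((kinds ×ˢ range h) ×ˢ configs (t + 1) m) with
        z.2.length + 1 = h + z.1.1.1.toNat + z.1.1.2.toNat ∧
          valW (pad z.2) + (z.1.1.1 && z.1.1.2).toNat = k,
        x ^ (h - 1 - z.1.2) * y ^ z.1.2 * weight x y z.2 := by
    rw [sum_filter, sum_product, sum_product]
    refine sum_congr rfl fun b _ => ?_
    rw [sum_mul]
    refine sum_congr rfl fun g _ => ?_
    rw [mul_sum, sum_filter]
  rw [e]
  have key : ∀ b g W, b ∈ kinds → g < h → IsConfig (t + 1) m W →
      W.length + 1 = h + b.1.toNat + b.2.toNat →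
      ∃ A u w B, A.length = g ∧ b = (!u.isEmpty, !w.isEmpty) ∧ W = split A u w B ∧
        B.length = h - 1 - g ∧ (u ≠ [] → w ≠ []) ∧ ins (t + 1) b g W = merge (t + 1) A u w B := by
    intro b g W hb hg hW hl
    obtain ⟨A, u, w, B, rfl, rfl, rfl, hB⟩ := exists_split hW.nil_notMem hg hl
    exact ⟨A, u, w, B, rfl, rfl, rfl, hB, (mem_kinds u w).1 hb, ins_split ..⟩
  symm
  refine sum_nbij (fun z => ins (t + 1) z.1.1 z.1.2 z.2) ?_ ?_ ?_ ?_
  · rintro ⟨⟨b, g⟩, W⟩ hz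
    simp only [mem_filter, mem_product, mem_range, mem_configs] at hz ⊢
    obtain ⟨⟨⟨hb, hg⟩, hW⟩, hl, hk⟩ := hz
    obtain ⟨A, u, w, B, rfl, rfl, rfl, hB, huw, hi⟩ := key b g W hb hg hW hl
    rw [hi]
    refine ⟨isConfig_merge_iff.2 ⟨huw, hW⟩, ?_, ?_⟩
    · simp [merge]; omega
    · rw [valW_merge t.succ_pos hW.lt huw, ← hk]
  · rintro ⟨⟨b, g⟩, W⟩ hz ⟨⟨b', g'⟩, W'⟩ hz' hzz
    simp only [coe_filter, Set.mem_ofPred_eq, mem_product, mem_range, mem_configs] at hz hz' hzz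
    obtain ⟨⟨⟨hb, hg⟩, hW⟩, hl, hk⟩ := hz
    obtain ⟨⟨⟨hb', hg'⟩, hW'⟩, hl', hk'⟩ := hz'
    obtain ⟨A, u, w, B, rfl, rfl, rfl, hB, huw, hi⟩ := key b g W hb hg hW hl
    obtain ⟨A', u', w', B', rfl, rfl, rfl, hB', huw', hi'⟩ := key b' g' W' hb' hg' hW' hl'
    rw [hi, hi'] at hzz
    have hv : t + 1 ∉ (split A u w B).flatten := fun h => by
      obtain ⟨a, ha, hx⟩ := List.mem_flatten.1 h
      exact lt_irrefl _ (hW.lt a ha _ hx)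
    obtain ⟨rfl, rfl, rfl, rfl⟩ := merge_inj hv hzz
    rfl
  · intro W' hW'
    simp only [coe_filter, Set.mem_ofPred_eq, mem_configs] at hW'
    obtain ⟨hW', hl, hk⟩ := hW'
    obtain ⟨A, u, w, B, rfl⟩ := hW'.exists_merge
    obtain ⟨huw, hW⟩ := isConfig_merge_iff.1 hW'
    refine ⟨(((!u.isEmpty, !w.isEmpty), A.length), split A u w B), ?_, ins_split ..⟩
    rw [valW_merge t.succ_pos hW.lt huw] at hk
    simp only [coe_filter, Set.mem_ofPred_eq, mem_product, mem_range, mem_configs, mem_kinds]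
    simp only [merge, List.length_append, List.length_cons] at hl
    refine ⟨⟨⟨huw, by omega⟩, hW⟩, ?_, hk⟩
    rw [length_split]; omega
  · rintro ⟨⟨b, g⟩, W⟩ hz
    simp only [mem_filter, mem_product, mem_range, mem_configs] at hz ⊢
    obtain ⟨⟨⟨hb, hg⟩, hW⟩, hl, hk⟩ := hz
    obtain ⟨A, u, w, B, rfl, rfl, rfl, hB, huw, hi⟩ := key b g W hb hg hW hl
    obtain ⟨hA', hB'⟩ := nil_notMem_split.1 hW.nil_notMem
    rw [hi, weight, weight, resW_merge t.succ_pos hW.lt hB',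
      resW_reverse_merge t.succ_pos hW.lt hA', hB]
    ring

lemma add_dvd_sum_pow_mul_pow (h : ℕ) (hh : Even h) :
    x + y ∣ ∑ g ∈ range h, x ^ (h - 1 - g) * y ^ g := by
  obtain ⟨j, rfl⟩ := hh
  induction j with
  | zero => simp
  | succ j ih =>
    have e : j + 1 + (j + 1) = j + j + 1 + 1 := by ring
    rw [e, sum_range_succ', sum_range_succ']
    have e₂ : ∑ g ∈ range (j + j), x ^ (j + j + 1 + 1 - 1 - (g + 1 + 1)) * y ^ (g + 1 + 1) =
        (∑ g ∈ range (j + j), x ^ (j + j - 1 - g) * y ^ g) * y ^ 2 := by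
      rw [sum_mul]
      refine sum_congr rfl fun g _ => ?_
      rw [show j + j + 1 + 1 - 1 - (g + 1 + 1) = j + j - 1 - g by omega]
      ring
    rw [e₂, add_assoc]
    refine dvd_add (ih.mul_right _) ⟨x ^ (j + j), ?_⟩
    simp
    ring

/-- Every insertion among `h` words contributes a factor `∑ x ^ (h - 1 - g) * y ^ g`, which is
divisible by `x + y` for even `h`. -/
theorem add_pow_dvd_configSum (m : ℕ) :
    ∀ t h k, (x + y) ^ (k + h / 2) ∣ configSum x y t m h k := by
  induction m with
  | zero =>
    intro t h k
    rw [configSum]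
    refine dvd_sum fun W hW => ?_
    simp only [mem_filter, mem_configs, isConfig_zero_iff] at hW
    obtain ⟨rfl, rfl, rfl⟩ := hW
    simp [pad, pre, valW]
  | succ m ih =>
    intro t h k
    rw [configSum_succ]
    refine dvd_sum fun b hb => ?_
    rcases h with _ | h
    · simp
    set S := ∑ W ∈ configs (t + 1) m with W.length + 1 = h + 1 + b.1.toNat + b.2.toNat ∧
          valW (pad W) + (b.1 && b.2).toNat = k, weight x y W with hS
    have hdvd : (x + y) ^ (k + h / 2) ∣ S := by
      simp only [kinds, mem_insert, mem_singleton] at hb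
      rcases hb with rfl | rfl | rfl
      · simpa [hS, configSum] using ih (t + 1) h k
      · have := ih (t + 1) (h + 1) k
        simp only [configSum] at this
        simp only [hS, Bool.toNat_false, Bool.toNat_true, Bool.false_and, add_zero,
          Nat.add_right_cancel_iff]
        exact (pow_dvd_pow _ (by omega)).trans this
      · rcases k with _ | k
        · simp [hS]
        · have := ih (t + 1) (h + 2) k
          simp only [configSum] at this
          simp only [hS, Bool.toNat_true, Bool.and_self, Nat.add_right_cancel_iff]
          exact (pow_dvd_pow _ (by omega)).trans this
    rcases Nat.even_or_odd h with hh | hh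
    · rw [show (h + 1) / 2 = h / 2 by have := hh.two_dvd; omega]
      exact hdvd.mul_left _
    · rw [show k + (h + 1) / 2 = 1 + (k + h / 2) by have := hh.add_one.two_dvd; omega, pow_add,
        pow_one]
      exact mul_dvd_mul (add_dvd_sum_pow_mul_pow x y (h + 1) hh.add_one) hdvd

lemma ascAt_map_range' (f : ℕ → ℕ) (x m s : ℕ) :
    ascAt x ((List.range' s m).map f) =
      ∑ j ∈ Ico s (s + m - 1), if f j < x ∧ x < f (j + 1) then 1 else 0 := by
  induction m generalizing s with
  | zero => simp [ascAt]
  | succ m ih =>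
    cases m with
    | zero => simp [ascAt]
    | succ m =>
      have := ih (s + 1)
      simp only [List.range'_succ, List.map_cons, ascAt] at this ⊢
      rw [this, sum_eq_sum_Ico_succ_bot (by omega : s < s + (m + 1 + 1) - 1),
        show s + 1 + (m + 1) - 1 = s + (m + 1 + 1) - 1 by omega]

lemma resW_map_range' (f : ℕ → ℕ) (m s : ℕ) :
    resW ((List.range' s m).map f) =
      ∑ i ∈ Ico s (s + m), ∑ j ∈ Ico (i + 1) (s + m - 1),
        if f j < f i ∧ f i < f (j + 1) then 1 else 0 := by
  induction m generalizing s with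
  | zero => simp [resW]
  | succ m ih =>
    rw [List.range'_succ, List.map_cons, resW, ih, ascAt_map_range',
      sum_eq_sum_Ico_succ_bot (by omega : s < s + (m + 1)),
      show s + 1 + m = s + (m + 1) by ring]

lemma valW_map_range' (f : ℕ → ℕ) (m s : ℕ) :
    valW ((List.range' s (m + 2)).map f) =
      ∑ i ∈ Ico (s + 1) (s + 1 + m),
        if 0 < f i ∧ f i < f (i - 1) ∧ f i < f (i + 1) then 1 else 0 := by
  induction m generalizing s with
  | zero => simp [valW, List.range'_succ]
  | succ m ih =>
    have := ih (s + 1)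
    simp only [List.range'_succ, List.map_cons, valW] at this ⊢
    rw [this, sum_eq_sum_Ico_succ_bot (by omega : s + 1 < s + 1 + (m + 1)),
      show s + 1 + 1 + m = s + 1 + (m + 1) by ring]
    simp

lemma ddW_map_range' (f : ℕ → ℕ) (m s : ℕ) :
    ddW ((List.range' s (m + 2)).map f) =
      ∑ i ∈ Ico (s + 1) (s + 1 + m),
        if f i < f (i - 1) ∧ f (i + 1) < f i then 1 else 0 := by
  induction m generalizing s with
  | zero => simp [ddW, List.range'_succ]
  | succ m ih =>
    have := ih (s + 1)
    simp only [List.range'_succ, List.map_cons, ddW] at this ⊢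
    rw [this, sum_eq_sum_Ico_succ_bot (by omega : s + 1 < s + 1 + (m + 1)),
      show s + 1 + 1 + m = s + 1 + (m + 1) by ring]
    simp

lemma resW_map_range (f : ℕ → ℕ) (n : ℕ) (h₀ : f 0 = 0) (h₁ : f (n + 1) = 0) :
    resW ((List.range (n + 2)).map f) =
      ((Icc 1 (n - 1) ×ˢ Icc 1 (n - 1)).filter
        fun p => p.1 < p.2 ∧ f p.2 < f p.1 ∧ f p.1 < f (p.2 + 1)).card := by
  rw [List.range_eq_range', resW_map_range']
  simp only [← card_filter]
  rw [← card_sigma]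
  refine card_nbij' (fun p => (p.1, p.2)) (fun p => ⟨p.1, p.2⟩) ?_ ?_ (fun _ _ => rfl)
    (fun _ _ => rfl)
  · rintro ⟨i, j⟩ h
    simp only [coe_sigma, coe_filter, Set.mem_sigma_iff, mem_coe, mem_Ico,
      Set.mem_ofPred_eq] at h
    obtain ⟨hi, ⟨hj, hj'⟩, h, h'⟩ := h
    have hi0 : i ≠ 0 := by rintro rfl; omega
    have hjn : j ≠ n := by rintro rfl; omega
    simp only [coe_filter, mem_product, mem_Icc, Set.mem_ofPred_eq]
    omega
  · rintro ⟨i, j⟩ h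
    simp only [coe_filter, mem_product, mem_Icc, Set.mem_ofPred_eq] at h
    simp only [coe_sigma, coe_filter, Set.mem_sigma_iff, mem_coe, mem_Ico, Set.mem_ofPred_eq]
    omega

section Perm

variable {n : ℕ} (σ : Equiv.Perm (Fin n))

/-- The one-line notation of a permutation of `{1, …, n}`. -/
def word : List ℕ := (List.finRange n).map fun i => (σ i : ℕ) + 1

lemma pval_zero : pval n σ 0 = 0 := by simp [pval]

lemma pval_add_one : pval n σ (n + 1) = 0 := by simp [pval]

lemma pval_pos {i : ℕ} (h₁ : 1 ≤ i) (h₂ : i ≤ n) : 0 < pval n σ i := by simp [pval, h₁, h₂]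

lemma word_eq : word σ = (List.range' 1 n).map (pval n σ) := by
  refine List.ext_getElem (by simp [word]) fun i h₁ h₂ => ?_
  have hi : i < n := by simpa [word] using h₁
  have e : 1 + i - 1 = i := by omega
  simp [word, pval, e, show 1 + i ≤ n by omega]

lemma pad_word : pad [word σ] = (List.range (n + 2)).map (pval n σ) := by
  rw [List.range_eq_range', List.range'_succ, List.range'_concat]
  simp [pad, pre, word_eq, pval_zero, add_comm 1 n, pval_add_one]

lemma pad_word_reverse :
    (pad [word σ]).reverse = (List.range (n + 2)).map fun i => pval n σ (n + 1 - i) := by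
  rw [pad_word]
  refine List.ext_getElem (by simp) fun i h₁ h₂ => ?_
  simp

lemma word_perm : (word σ).Perm (List.range' 1 n) := by
  have e : word σ = ((List.finRange n).map σ).map fun i : Fin n => (i : ℕ) + 1 := by simp [word]
  have e' : List.range' 1 n = (List.finRange n).map fun i : Fin n => (i : ℕ) + 1 := by
    refine List.ext_getElem (by simp) fun i h₁ h₂ => ?_
    simp [add_comm]
  rw [e, e']
  exact (Equiv.Perm.map_finRange_perm σ).map _

lemma resW_word : resW (pad [word σ]) = res n σ := by
  rw [pad_word, resW_map_range _ _ (pval_zero σ) (pval_add_one σ), res]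

lemma resW_reverse_word : resW (pad [word σ]).reverse = les n σ := by
  rw [pad_word_reverse, resW_map_range _ _ (by simp [pval_add_one]) (by simp [pval_zero]), les]
  refine card_nbij' (fun p => (n + 1 - p.2, n + 1 - p.1)) (fun p => (n + 1 - p.2, n + 1 - p.1))
    ?_ ?_ ?_ ?_
  · rintro ⟨i, j⟩ h
    simp only [coe_filter, mem_product, mem_Icc, Set.mem_ofPred_eq] at h ⊢
    rw [show n + 1 - j - 1 = n + 1 - (j + 1) by omega]
    omega
  · rintro ⟨i, j⟩ h
    simp only [coe_filter, mem_product, mem_Icc, Set.mem_ofPred_eq] at h ⊢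
    rw [show n + 1 - (n + 1 - i + 1) = i - 1 by omega, show n + 1 - (n + 1 - i) = i by omega,
      show n + 1 - (n + 1 - j) = j by omega]
    omega
  · rintro ⟨i, j⟩ h
    simp only [coe_filter, mem_product, mem_Icc, Set.mem_ofPred_eq] at h
    ext <;> simp <;> omega
  · rintro ⟨i, j⟩ h
    simp only [coe_filter, mem_product, mem_Icc, Set.mem_ofPred_eq] at h
    ext <;> simp <;> omega

lemma valW_word : valW (pad [word σ]) = valleys n σ := by
  rw [pad_word, List.range_eq_range', valW_map_range', ← card_filter, valleys]
  congr 1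
  ext i
  simp only [mem_filter, mem_Ico, mem_Icc]
  constructor
  · rintro ⟨h, -, h'⟩
    exact ⟨by omega, h'⟩
  · rintro ⟨h, h'⟩
    exact ⟨by omega, pval_pos σ h.1 h.2, h'⟩

lemma ddW_word : ddW (pad [word σ]) = ddes n σ := by
  rw [pad_word, List.range_eq_range', ddW_map_range', ← card_filter, ddes]
  congr 1
  ext i
  simp only [mem_filter, mem_Ico, mem_Icc]
  refine and_congr_left fun _ => by omega

lemma isConfig_word_iff (hn : 0 < n) : IsConfig 0 n [word σ] ↔ ddes n σ = 0 := by
  constructor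
  · rintro ⟨-, -, h⟩
    rwa [ddW_word] at h
  · intro h
    refine ⟨by simpa using word_perm σ, ?_, by rwa [ddW_word]⟩
    have : word σ ≠ [] := by simp [word, hn.ne']
    simpa using this.symm

lemma word_injective : Function.Injective (word : Equiv.Perm (Fin n) → List ℕ) := by
  intro σ τ h
  ext i
  have := List.map_inj_left.1 h i (List.mem_finRange i)
  omega

lemma exists_word_eq {w : List ℕ} (hw : w.Perm (List.range' 1 n)) :
    ∃ σ : Equiv.Perm (Fin n), word σ = w := by
  have hl : w.length = n := by simpa using hw.length_eq
  have hmem : ∀ (i : ℕ) (h : i < w.length), 1 ≤ w[i] ∧ w[i] < 1 + n := fun i h =>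
    List.mem_range'_1.1 (hw.mem_iff.1 (List.getElem_mem h))
  let f : Fin n → Fin n := fun i =>
    ⟨w[(i : ℕ)]'(hl.symm ▸ i.2) - 1, by have := hmem i (hl.symm ▸ i.2); omega⟩
  have hf : Function.Injective f := by
    intro i j h
    have hi := hmem i (hl.symm ▸ i.2)
    have hj := hmem j (hl.symm ▸ j.2)
    have h := congrArg Fin.val h
    simp only [f] at h
    have hnd : w.Nodup := hw.nodup_iff.2 List.nodup_range'
    exact Fin.ext ((hnd.getElem_inj_iff).1 (by omega))
  refine ⟨Equiv.ofBijective f (Finite.injective_iff_bijective.1 hf),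
    List.ext_getElem (by simp [word, hl]) fun i h₁ h₂ => ?_⟩
  have := hmem i h₂
  simp [word, f]
  omega

end Perm

lemma sum_Snk_eq_configSum {R : Type*} [CommRing R] (x y : R) {n : ℕ} (hn : 0 < n) (k : ℕ) :
    ∑ σ ∈ Snk n k, x ^ res n σ * y ^ les n σ = configSum x y 0 n 1 k := by
  refine sum_nbij (fun σ => [word σ]) ?_ ?_ ?_ ?_
  · intro σ hσ
    simp only [Snk, mem_filter, mem_univ, true_and] at hσ
    simp [mem_configs, isConfig_word_iff σ hn, valW_word, hσ]
  · intro σ _ τ _ h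
    exact word_injective (List.singleton_inj.1 h)
  · intro W hW
    simp only [coe_filter, Set.mem_ofPred_eq, mem_configs, List.length_eq_one_iff] at hW
    obtain ⟨hW, ⟨w, rfl⟩, hval⟩ := hW
    obtain ⟨σ, rfl⟩ := exists_word_eq (by simpa using hW.perm)
    refine ⟨σ, ?_, rfl⟩
    rw [valW_word] at hval
    simp [Snk, hval, (isConfig_word_iff σ hn).1 hW]
  · intro σ _
    rw [weight, resW_word, resW_reverse_word]

end PaddedWord

/-- `a_{n,k}(p,q) = Σ_{σ ∈ S_{n,k}} p^(res σ) q^(les σ)` is divisible by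
`(p+q)^k` in `ℤ[p,q]`. -/
theorem statement4 (n k : ℕ) (hn : 0 < n) (hk : k ≤ (n - 1) / 2) :
    ((X 0 : MvPolynomial (Fin 2) ℤ) + X 1) ^ k ∣
      ∑ σ ∈ Snk n k, (X 0 : MvPolynomial (Fin 2) ℤ) ^ (res n σ) * (X 1) ^ (les n σ) := by
  rw [PaddedWord.sum_Snk_eq_configSum _ _ hn]
  simpa using PaddedWord.add_pow_dvd_configSum (X 0 : MvPolynomial (Fin 2) ℤ) (X 1) n 0 1 k
end

section
/- For every positive integer n, there exists a bijection Φ : S_n → S_n such that for all σ ∈ S_n one has nest σ = ress Φ(σ), cros σ = les Φ(σ), and drop σ = des Φ(σ). -/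
open Finset MvPolynomial

/-- `s` and `t` are mutually inverse permutations of `{1,…,n}`, and vanish outside it. -/
structure IsPermPair (n : ℕ) (s t : ℕ → ℕ) : Prop where
  s_mem : ∀ i, 1 ≤ i → i ≤ n → 1 ≤ s i ∧ s i ≤ n
  t_mem : ∀ i, 1 ≤ i → i ≤ n → 1 ≤ t i ∧ t i ≤ n
  t_s : ∀ i, 1 ≤ i → i ≤ n → t (s i) = i
  s_t : ∀ i, 1 ≤ i → i ≤ n → s (t i) = i
  s_zero : s 0 = 0
  t_zero : t 0 = 0
  s_out : ∀ i, n < i → s i = 0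
  t_out : ∀ i, n < i → t i = 0

theorem pval_of_mem {n : ℕ} (σ : Equiv.Perm (Fin n)) {i : ℕ} (h₁ : 1 ≤ i) (h₂ : i ≤ n) :
    pval n σ i = (σ ⟨i - 1, by omega⟩ : ℕ) + 1 := by
  simp [pval, h₁, h₂]

theorem pval_mem {n : ℕ} (σ : Equiv.Perm (Fin n)) {i : ℕ} (h₁ : 1 ≤ i) (h₂ : i ≤ n) :
    1 ≤ pval n σ i ∧ pval n σ i ≤ n := by
  rw [pval_of_mem σ h₁ h₂]
  have := (σ ⟨i - 1, by omega⟩).isLt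
  omega

theorem pval_inv_pval {n : ℕ} (σ : Equiv.Perm (Fin n)) {i : ℕ} (h₁ : 1 ≤ i) (h₂ : i ≤ n) :
    pval n σ⁻¹ (pval n σ i) = i := by
  have h := pval_mem σ h₁ h₂
  rw [pval_of_mem σ⁻¹ h.1 h.2]
  simp only [pval_of_mem σ h₁ h₂, Nat.add_sub_cancel, Fin.eta, Equiv.Perm.inv_def, Equiv.symm_apply_apply]
  omega

theorem isPermPair_pval {n : ℕ} (σ : Equiv.Perm (Fin n)) :
    IsPermPair n (pval n σ) (pval n σ⁻¹) where
  s_mem _ := pval_mem σ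
  t_mem _ := pval_mem σ⁻¹
  t_s _ := pval_inv_pval σ
  s_t i h₁ h₂ := by simpa using pval_inv_pval σ⁻¹ h₁ h₂
  s_zero := by simp [pval]
  t_zero := by simp [pval]
  s_out i hi := by simp [pval]; omega
  t_out i hi := by simp [pval]; omega

theorem perm_ext_of_pval_inv {n : ℕ} {σ τ : Equiv.Perm (Fin n)}
    (h : ∀ v, 1 ≤ v → v ≤ n → pval n σ⁻¹ v = pval n τ⁻¹ v) : σ = τ := by
  apply inv_injective
  ext i
  have := h (i + 1) (by omega) i.isLt
  rw [pval_of_mem _ (by omega) i.isLt, pval_of_mem _ (by omega) i.isLt] at this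
  simpa using this

/-- Codes of length `m` ending at height `h`: at each step `(a, d, c)` the height changes by
`a - d`, with `a, d ∈ {0, 1}`, and `c + d` is at most the height before the step. -/
def codes : ℕ → ℕ → Finset (List (ℕ × ℕ × ℕ))
  | 0, h => if h = 0 then {[]} else ∅
  | m + 1, h =>
    ((codes m h ×ˢ range (h + 1)).image (fun x => (0, 0, x.2) :: x.1) ∪
      (codes m (h + 1) ×ˢ range (h + 1)).image (fun x => (0, 1, x.2) :: x.1)) ∪
    ((codes m (h - 1) ×ˢ range h).image (fun x => (1, 0, x.2) :: x.1) ∪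
      (codes m h ×ˢ range h).image (fun x => (1, 1, x.2) :: x.1))

theorem card_codes_le (m h : ℕ) : (codes m h).card ≤ m.factorial * m.choose h := by
  induction m generalizing h with
  | zero => rcases h with _ | h <;> simp [codes]
  | succ m ih =>
    have hcard : (codes (m + 1) h).card ≤
        ((codes m h).card * (h + 1) + (codes m (h + 1)).card * (h + 1)) +
          ((codes m (h - 1)).card * h + (codes m h).card * h) := by
      rw [codes]
      refine (card_union_le _ _).trans (add_le_add ((card_union_le _ _).trans ?_)
        ((card_union_le _ _).trans ?_)) <;>
      refine add_le_add (card_image_le.trans ?_) (card_image_le.trans ?_) <;>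
      simp [card_product]
    refine hcard.trans ?_
    have e₂ : (m + 1).choose (h + 1) = m.choose h + m.choose (h + 1) := Nat.choose_succ_succ _ _
    have e₃ : (m.choose (h - 1) + m.choose h) * h = (m + 1).choose h * h := by
      rcases h with _ | h
      · simp
      · simp [Nat.choose_succ_succ]
    have e₄ : (m.choose h + m.choose (h + 1)) * (h + 1) + (m.choose (h - 1) + m.choose h) * h
        = (m + 1) * (m + 1).choose h := by
      rcases le_or_gt h (m + 1) with hle | hlt
      · rw [e₃, ← e₂, Nat.choose_succ_right_eq, ← mul_add, mul_comm, Nat.sub_add_cancel hle]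
      · simp [e₃, ← e₂, Nat.choose_eq_zero_of_lt hlt,
          Nat.choose_eq_zero_of_lt (by omega : m + 1 < h + 1)]
    calc _ ≤ (m.factorial * m.choose h * (h + 1) + m.factorial * m.choose (h + 1) * (h + 1)) +
          (m.factorial * m.choose (h - 1) * h + m.factorial * m.choose h * h) := by
            gcongr <;> apply ih
      _ = m.factorial * ((m.choose h + m.choose (h + 1)) * (h + 1) +
          (m.choose (h - 1) + m.choose h) * h) := by ring
      _ = (m + 1).factorial * (m + 1).choose h := by
            rw [e₄, Nat.factorial_succ]; ring

/-- The list of the steps `x m, …, x 1`. -/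
def codeList (x : ℕ → ℕ × ℕ × ℕ) : ℕ → List (ℕ × ℕ × ℕ)
  | 0 => []
  | m + 1 => x (m + 1) :: codeList x m

theorem codeList_eq_iff {x y : ℕ → ℕ × ℕ × ℕ} {m : ℕ} :
    codeList x m = codeList y m ↔ ∀ v, 1 ≤ v → v ≤ m → x v = y v := by
  induction m with
  | zero => simp [codeList]; omega
  | succ m ih =>
    rw [codeList, codeList, List.cons.injEq, ih]
    constructor
    · rintro ⟨h, h'⟩ v h₁ h₂
      rcases Nat.lt_or_ge m v with hv | hv
      · rwa [show v = m + 1 by omega]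
      · exact h' v h₁ hv
    · exact fun h => ⟨h _ (by omega) le_rfl, fun v h₁ h₂ => h v h₁ (by omega)⟩

/-- The steps `x 1, …, x n` form a code with heights `H 0, …, H n`, and `N v` is the slack
in the bound on the last component of `x v`. -/
structure IsCode (n : ℕ) (x : ℕ → ℕ × ℕ × ℕ) (N H : ℕ → ℕ) : Prop where
  zero : H 0 = 0
  last : H n = 0
  fst_le : ∀ v, (x v).1 ≤ 1
  snd_le : ∀ v, (x v).2.1 ≤ 1
  height : ∀ v, v < n → H (v + 1) + (x (v + 1)).2.1 = H v + (x (v + 1)).1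
  slack : ∀ v, v < n → (x (v + 1)).2.2 + N (v + 1) + (x (v + 1)).2.1 = H v

theorem IsCode.codeList_mem_codes {n : ℕ} {x : ℕ → ℕ × ℕ × ℕ} {N H : ℕ → ℕ}
    (hx : IsCode n x N H) {m : ℕ} (hm : m ≤ n) : codeList x m ∈ codes m (H m) := by
  induction m with
  | zero => simp [codeList, codes, hx.zero]
  | succ m ih =>
    have ih := ih (by omega)
    have h₁ := hx.height m (by omega)
    have h₂ := hx.slack m (by omega)
    have h₃ := hx.fst_le (m + 1)
    have h₄ := hx.snd_le (m + 1)
    rw [codeList, codes]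
    rcases hstep : x (m + 1) with ⟨a, d, c⟩
    simp only [hstep] at h₁ h₂ h₃ h₄
    simp only [mem_union, mem_image, mem_product, mem_range, List.cons.injEq, Prod.mk.injEq,
      Prod.exists]
    rcases Nat.le_one_iff_eq_zero_or_eq_one.1 h₃ with rfl | rfl <;>
    rcases Nat.le_one_iff_eq_zero_or_eq_one.1 h₄ with rfl | rfl
    · exact Or.inl (Or.inl ⟨_, c, ⟨by rwa [show H (m + 1) = H m by omega], by omega⟩, by simp⟩)
    · exact Or.inl (Or.inr ⟨_, c, ⟨by rwa [show H (m + 1) + 1 = H m by omega], by omega⟩,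
        by simp⟩)
    · exact Or.inr (Or.inl ⟨_, c, ⟨by rwa [show H (m + 1) - 1 = H m by omega], by omega⟩,
        by simp⟩)
    · exact Or.inr (Or.inr ⟨_, c, ⟨by rwa [show H (m + 1) = H m by omega], by omega⟩, by simp⟩)

theorem IsCode.slack_eq {n : ℕ} {x y : ℕ → ℕ × ℕ × ℕ} {N N' H H' : ℕ → ℕ}
    (hx : IsCode n x N H) (hy : IsCode n y N' H') (hxy : ∀ v, 1 ≤ v → v ≤ n → x v = y v)
    {v : ℕ} (h₁ : 1 ≤ v) (h₂ : v ≤ n) : N v = N' v := by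
  have hH : ∀ m, m ≤ n → H m = H' m := by
    intro m hm
    induction m with
    | zero => rw [hx.zero, hy.zero]
    | succ m ih =>
      have e₁ := hx.height m (by omega)
      have e₂ := hy.height m (by omega)
      rw [hxy _ (by omega) hm] at e₁
      have := ih (by omega)
      omega
  obtain ⟨m, rfl⟩ : ∃ m, v = m + 1 := ⟨v - 1, by omega⟩
  have e₁ := hx.slack m (by omega)
  have e₂ := hy.slack m (by omega)
  rw [hxy _ h₁ h₂] at e₁
  have := hH m (by omega)
  omega

/-- A faithful encoding of permutations of `Fin n` by codes attains every code. -/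
theorem bijective_codeList {n : ℕ} {x : Equiv.Perm (Fin n) → ℕ → ℕ × ℕ × ℕ}
    {N H : Equiv.Perm (Fin n) → ℕ → ℕ} (hx : ∀ σ, IsCode n (x σ) (N σ) (H σ))
    (hinj : ∀ σ τ, (∀ v, 1 ≤ v → v ≤ n → x σ v = x τ v) → σ = τ) :
    Function.Bijective (fun σ : Equiv.Perm (Fin n) =>
      (⟨codeList (x σ) n, (hx σ).last ▸ (hx σ).codeList_mem_codes le_rfl⟩ : codes n 0)) := by
  refine Function.Injective.bijective_of_nat_card_le ?_ ?_
  · intro σ τ h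
    exact hinj σ τ (codeList_eq_iff.1 (Subtype.ext_iff.1 h))
  · simpa [Fintype.card_perm] using card_codes_le n 0

theorem exists_equiv_of_codes {n : ℕ} {x y : Equiv.Perm (Fin n) → ℕ → ℕ × ℕ × ℕ}
    {N N' H H' : Equiv.Perm (Fin n) → ℕ → ℕ} (hx : ∀ σ, IsCode n (x σ) (N σ) (H σ))
    (hy : ∀ σ, IsCode n (y σ) (N' σ) (H' σ))
    (hxinj : ∀ σ τ, (∀ v, 1 ≤ v → v ≤ n → x σ v = x τ v) → σ = τ)
    (hyinj : ∀ σ τ, (∀ v, 1 ≤ v → v ≤ n → y σ v = y τ v) → σ = τ) :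
    ∃ Φ : Equiv.Perm (Fin n) ≃ Equiv.Perm (Fin n), ∀ σ v, 1 ≤ v → v ≤ n →
      x σ v = y (Φ σ) v ∧ N σ v = N' (Φ σ) v := by
  let e := Equiv.ofBijective _ (bijective_codeList hx hxinj)
  let f := Equiv.ofBijective _ (bijective_codeList hy hyinj)
  refine ⟨e.trans f.symm, fun σ => ?_⟩
  have h : f (f.symm (e σ)) = e σ := f.apply_symm_apply _
  have hxy := codeList_eq_iff.1 (Subtype.ext_iff.1 h).symm
  exact fun v h₁ h₂ => ⟨hxy v h₁ h₂, (hx σ).slack_eq (hy _) hxy h₁ h₂⟩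

namespace IsPermPair

variable {n : ℕ} {s t s' t' : ℕ → ℕ}

theorem symm (h : IsPermPair n s t) : IsPermPair n t s :=
  ⟨h.t_mem, h.s_mem, h.s_t, h.t_s, h.t_zero, h.s_zero, h.t_out, h.s_out⟩

theorem sum_comp (h : IsPermPair n s t) (g : ℕ → ℕ) :
    ∑ i ∈ Icc 1 n, g i = ∑ v ∈ Icc 1 n, g (t v) := by
  refine sum_nbij' s t ?_ ?_ ?_ ?_ ?_ <;> intro i hi <;> rw [mem_Icc] at hi
  · exact mem_Icc.2 (h.s_mem i hi.1 hi.2)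
  · exact mem_Icc.2 (h.t_mem i hi.1 hi.2)
  · exact h.t_s i hi.1 hi.2
  · exact h.s_t i hi.1 hi.2
  · rw [h.t_s i hi.1 hi.2]

theorem card_filter_le (h : IsPermPair n s t) {k : ℕ} (hk : k ≤ n) :
    #{i ∈ Icc 1 n | s i ≤ k} = k := by
  rw [card_filter, h.sum_comp, ← card_filter]
  have : {i ∈ Icc 1 n | s (t i) ≤ k} = Icc 1 k := by
    ext i
    simp only [mem_filter, mem_Icc]
    constructor
    · rintro ⟨hi, h'⟩
      rw [h.s_t i hi.1 hi.2] at h'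
      exact ⟨hi.1, h'⟩
    · rintro ⟨h₁, h₂⟩
      rw [h.s_t i h₁ (by omega)]
      omega
  simp [this]

end IsPermPair

theorem sum_Icc_ite_eq_and {n a : ℕ} (h : 1 ≤ a) (P : Prop) [Decidable P] :
    ∑ i ∈ Icc 1 n, (if i = a ∧ P then 1 else 0) = if a ≤ n ∧ P then 1 else 0 := by
  by_cases hP : P
  · simp [hP, h]
  · simp [hP]

theorem sum_Icc_ite_eq_and_of_le {n a : ℕ} (h₁ : 1 ≤ a) (h₂ : a ≤ n) (P : Prop) [Decidable P] :
    ∑ i ∈ Icc 1 n, (if i = a ∧ P then 1 else 0) = if P then 1 else 0 := by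
  simp [sum_Icc_ite_eq_and h₁, h₂]

/-- The arcs of `s` crossing the arc `t v → v`, counted from its end at `v`. -/
def arcCros (n : ℕ) (s t : ℕ → ℕ) (v : ℕ) : ℕ :=
  if t v ≤ v then #{i ∈ Icc 1 n | t v < i ∧ i ≤ v ∧ v < s i}
  else #{i ∈ Icc 1 n | v < i ∧ i < t v ∧ s i < v}

/-- The arcs of `s` in which the arc `t v → v` is nested. -/
def arcNest (n : ℕ) (s t : ℕ → ℕ) (v : ℕ) : ℕ :=
  if t v ≤ v then #{i ∈ Icc 1 n | i < t v ∧ v < s i}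
  else #{i ∈ Icc 1 n | t v < i ∧ s i < v}

/-- The number of arcs of `s` going from the right of `v` to `v` or to its left. -/
def arcHeight (n : ℕ) (s : ℕ → ℕ) (v : ℕ) : ℕ :=
  #{i ∈ Icc 1 n | v < i ∧ s i ≤ v}

/-- The step at `v` of the code of `s` read from its arc diagram. -/
def arcStep (n : ℕ) (s t : ℕ → ℕ) (v : ℕ) : ℕ × ℕ × ℕ :=
  (if v < t v then 1 else 0, if s v < v then 1 else 0, arcCros n s t v)

namespace IsPermPair

variable {n : ℕ} {s t s' t' : ℕ → ℕ}

theorem arcHeight_succ (h : IsPermPair n s t) {v : ℕ} (hv : v < n) :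
    arcHeight n s (v + 1) + (if s (v + 1) < v + 1 then 1 else 0) =
      arcHeight n s v + (if v + 1 < t (v + 1) then 1 else 0) := by
  have ht := h.t_mem (v + 1) (by omega) hv
  have hst := h.s_t (v + 1) (by omega) hv
  rw [arcHeight, arcHeight, card_filter, card_filter,
    ← sum_Icc_ite_eq_and_of_le (n := n) (a := v + 1) (by omega) hv,
    ← sum_Icc_ite_eq_and_of_le ht.1 ht.2, ← sum_add_distrib, ← sum_add_distrib]
  refine sum_congr rfl fun i hi => ?_
  rw [mem_Icc] at hi
  have hts := h.t_s i hi.1 hi.2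
  grind

theorem card_up_arcs (h : IsPermPair n s t) {v : ℕ} (hv : v ≤ n) :
    #{i ∈ Icc 1 n | i ≤ v ∧ v < s i} = arcHeight n s v := by
  have h₁ := h.card_filter_le hv
  have h₂ : #{i ∈ Icc 1 n | i ≤ v} = v := by
    rw [show ({i ∈ Icc 1 n | i ≤ v} : Finset ℕ) = Icc 1 v by ext; simp; omega]
    simp
  have h₃ : #{i ∈ Icc 1 n | i ≤ v ∧ v < s i} + #{i ∈ Icc 1 n | s i ≤ v} =
      arcHeight n s v + #{i ∈ Icc 1 n | i ≤ v} := by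
    simp only [arcHeight, card_filter, ← sum_add_distrib]
    refine sum_congr rfl fun i hi => ?_
    grind
  omega

theorem arc_slack (h : IsPermPair n s t) {v : ℕ} (hv : v < n) :
    arcCros n s t (v + 1) + arcNest n s t (v + 1) + (if s (v + 1) < v + 1 then 1 else 0) =
      arcHeight n s v := by
  have ht := h.t_mem (v + 1) (by omega) hv
  have hst := h.s_t (v + 1) (by omega) hv
  by_cases hA : t (v + 1) ≤ v + 1
  · have h₁ := h.arcHeight_succ hv
    rw [← h.card_up_arcs (by omega), if_neg (by omega : ¬ v + 1 < t (v + 1))] at h₁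
    rw [add_zero] at h₁
    rw [← h₁, arcCros, arcNest, if_pos hA, if_pos hA]
    congr 1
    simp only [card_filter, ← sum_add_distrib]
    refine sum_congr rfl fun i hi => ?_
    grind
  · rw [arcCros, arcNest, if_neg hA, if_neg hA, arcHeight,
      ← sum_Icc_ite_eq_and_of_le (n := n) (a := v + 1) (by omega) hv]
    simp only [card_filter, ← sum_add_distrib]
    refine sum_congr rfl fun i hi => ?_
    grind

theorem isCode_arcStep (h : IsPermPair n s t) :
    IsCode n (arcStep n s t) (arcNest n s t) (arcHeight n s) where
  zero := by
    rw [arcHeight, card_eq_zero, filter_eq_empty_iff]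
    intro i hi
    rw [mem_Icc] at hi
    have := h.s_mem i hi.1 hi.2
    omega
  last := by
    rw [arcHeight, card_eq_zero, filter_eq_empty_iff]
    intro i hi
    rw [mem_Icc] at hi
    omega
  fst_le v := by rw [arcStep]; dsimp only; split_ifs <;> omega
  snd_le v := by rw [arcStep]; dsimp only; split_ifs <;> omega
  height v hv := h.arcHeight_succ hv
  slack v hv := h.arc_slack hv

theorem t_ne_of_ne (h : IsPermPair n s t) {u v : ℕ} (hu : 1 ≤ u) (hu' : u ≤ n) (hv : 1 ≤ v)
    (hvn : v ≤ n) (huv : u ≠ v) : t u ≠ t v := by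
  intro e
  apply huv
  rw [← h.s_t u hu hu', e, h.s_t v hv hvn]

/-- Forward arcs are determined from left to right by the code. -/
theorem not_t_lt_of_le (h : IsPermPair n s t) (h' : IsPermPair n s' t')
    (hx : ∀ v, 1 ≤ v → v ≤ n → arcStep n s t v = arcStep n s' t' v) {v : ℕ} (hv : 1 ≤ v)
    (hv' : v ≤ n) (ih : ∀ u, 1 ≤ u → u < v → t u ≤ u → t u = t' u) (hA : t v ≤ v) :
    ¬ t v < t' v := by
  intro hlt
  have hD : ∀ k, 1 ≤ k → k ≤ n → (s k < k ↔ s' k < k) := by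
    intro k h₁ h₂
    have := congrArg (fun x => x.2.1) (hx k h₁ h₂)
    simp only [arcStep] at this
    grind
  have hA' : ∀ k, 1 ≤ k → k ≤ n → (k < t k ↔ k < t' k) := by
    intro k h₁ h₂
    have := congrArg (fun x => x.1) (hx k h₁ h₂)
    simp only [arcStep] at this
    grind
  have hc := congrArg (fun x => x.2.2) (hx v hv hv')
  have hAv := hA' v hv hv'
  simp only [arcStep, arcCros] at hc
  rw [if_pos hA, if_pos (by omega)] at hc
  have htv := h.t_mem v hv hv'
  have htv' := h'.t_mem v hv hv'
  have key : ∀ k, 1 ≤ k → k ≤ v → k ≤ s' k → k ≠ t v → v ≤ s' k → v < s k := by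
    intro k h₁ h₂ h₃ h₄ h₅
    have hk := hD k h₁ (by omega)
    have hs := h.s_mem k h₁ (by omega)
    have hts := h.t_s k h₁ (by omega)
    have hts' := h'.t_s k h₁ (by omega)
    by_contra hlt
    rcases Nat.lt_or_ge (s k) v with hl | hl
    · have e := ih (s k) hs.1 hl (by omega)
      have e' := h'.s_t (s k) hs.1 (by omega)
      rw [← e, hts] at e'
      omega
    · exact h₄ (by rw [show v = s k by omega, hts])
  refine absurd hc (ne_of_gt (card_lt_card ?_))
  rw [ssubset_iff_of_subset]
  · refine ⟨t' v, ?_, ?_⟩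
    · have := h'.s_t v hv hv'
      simp only [mem_filter, mem_Icc]
      exact ⟨htv', hlt, by omega, key _ htv'.1 (by omega) (by omega) (by omega) (by omega)⟩
    · simp
  · intro k hk
    simp only [mem_filter, mem_Icc] at hk ⊢
    exact ⟨hk.1, by omega, by omega, key k hk.1.1 (by omega) (by omega) (by omega) (by omega)⟩

/-- Backward arcs are determined from right to left by the code. -/
theorem not_t_lt_of_gt (h : IsPermPair n s t) (h' : IsPermPair n s' t')
    (hx : ∀ v, 1 ≤ v → v ≤ n → arcStep n s t v = arcStep n s' t' v) {v : ℕ} (hv : 1 ≤ v)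
    (hv' : v ≤ n) (ih : ∀ u, u ≤ n → v < u → u < t' u → t u = t' u) (hA : v < t v) :
    ¬ t v < t' v := by
  intro hlt
  have hD : ∀ k, 1 ≤ k → k ≤ n → (s k < k ↔ s' k < k) := by
    intro k h₁ h₂
    have := congrArg (fun x => x.2.1) (hx k h₁ h₂)
    simp only [arcStep] at this
    grind
  have hc := congrArg (fun x => x.2.2) (hx v hv hv')
  simp only [arcStep, arcCros] at hc
  rw [if_neg (by omega), if_neg (by omega)] at hc
  have htv := h.t_mem v hv hv'
  have htv' := h'.t_mem v hv hv'
  have key : ∀ k, v < k → k ≤ n → s k < k → k ≠ t' v → s k ≤ v → s' k < v := by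
    intro k h₁ h₂ h₃ h₄ h₅
    have hk := hD k (by omega) h₂
    have hs := h'.s_mem k (by omega) h₂
    have hts := h.t_s k (by omega) h₂
    have hts' := h'.t_s k (by omega) h₂
    by_contra hlt
    rcases Nat.lt_or_ge v (s' k) with hl | hl
    · have e := ih (s' k) hs.2 hl (by omega)
      have e' := h.s_t (s' k) hs.1 (by omega)
      rw [e, hts'] at e'
      omega
    · exact h₄ (by rw [show v = s' k by omega, hts'])
  refine absurd hc (ne_of_lt (card_lt_card ?_))
  rw [ssubset_iff_of_subset]
  · refine ⟨t v, ?_, ?_⟩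
    · have := h.s_t v hv hv'
      simp only [mem_filter, mem_Icc]
      exact ⟨htv, hA, hlt, key _ hA htv.2 (by omega) (by omega) (by omega)⟩
    · simp
  · intro k hk
    simp only [mem_filter, mem_Icc] at hk ⊢
    exact ⟨hk.1, by omega, by omega, key k (by omega) (by omega) (by omega) (by omega) (by omega)⟩

theorem eq_of_arcStep_eq (h : IsPermPair n s t) (h' : IsPermPair n s' t')
    (hx : ∀ v, 1 ≤ v → v ≤ n → arcStep n s t v = arcStep n s' t' v) {v : ℕ} (hv : 1 ≤ v)
    (hv' : v ≤ n) : t v = t' v := by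
  have hx' : ∀ v, 1 ≤ v → v ≤ n → arcStep n s' t' v = arcStep n s t v :=
    fun v h₁ h₂ => (hx v h₁ h₂).symm
  have hA : ∀ k, 1 ≤ k → k ≤ n → (k < t k ↔ k < t' k) := by
    intro k h₁ h₂
    have := congrArg (fun x => x.1) (hx k h₁ h₂)
    simp only [arcStep] at this
    grind
  rcases Nat.lt_or_ge v (t v) with hlt | hge
  · have key : ∀ m v, 1 ≤ v → v + m = n → v < t v → t v = t' v := by
      intro m
      induction m using Nat.strong_induction_on with
      | _ m ih =>
        intro v h₁ h₂ h₃
        have ih' : ∀ u, u ≤ n → v < u → u < t u → t u = t' u :=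
          fun u hu hvu => ih (n - u) (by omega) u (by omega) (by omega)
        have e₁ := h.not_t_lt_of_gt h' hx h₁ (by omega)
          (fun u hu hvu hu' => ih' u hu hvu ((hA u (by omega) hu).2 hu')) h₃
        have e₂ := h'.not_t_lt_of_gt h hx' h₁ (by omega)
          (fun u hu hvu hu' => (ih' u hu hvu hu').symm) ((hA v h₁ (by omega)).1 h₃)
        omega
    exact key (n - v) v hv (by omega) hlt
  · induction v using Nat.strong_induction_on with
    | _ v ih =>
      have ih' : ∀ u, 1 ≤ u → u < v → t u ≤ u → t u = t' u :=
        fun u hu huv => ih u huv hu (by omega)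
      have e₁ := h.not_t_lt_of_le h' hx hv hv' ih' hge
      have e₂ := h'.not_t_lt_of_le h hx' hv hv'
        (fun u hu huv hu' => (ih' u hu huv (by have := hA u hu (by omega); omega)).symm)
        (by have := hA v hv hv'; omega)
      omega

end IsPermPair

theorem cros_eq_sum (n : ℕ) (σ : Equiv.Perm (Fin n)) :
    cros n σ = ∑ v ∈ Icc 1 n, (arcStep n (pval n σ) (pval n σ⁻¹) v).2.2 := by
  have h := isPermPair_pval σ
  rw [cros, card_filter, sum_product, h.sum_comp]
  refine sum_congr rfl fun v hv => ?_
  rw [mem_Icc] at hv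
  rw [← card_filter]
  simp only [h.s_t v hv.1 hv.2, arcStep, arcCros]
  split_ifs with hA <;> congr 1 <;> ext i <;> grind

theorem nest_eq_sum (n : ℕ) (σ : Equiv.Perm (Fin n)) :
    nest n σ = ∑ v ∈ Icc 1 n, arcNest n (pval n σ) (pval n σ⁻¹) v := by
  have h := isPermPair_pval σ
  rw [nest, card_filter, sum_product_right, h.sum_comp]
  refine sum_congr rfl fun v hv => ?_
  rw [mem_Icc] at hv
  rw [← card_filter]
  simp only [h.s_t v hv.1 hv.2, arcNest]
  split_ifs with hA <;> congr 1 <;> ext i <;> grind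

theorem drp_eq_sum (n : ℕ) (σ : Equiv.Perm (Fin n)) :
    drp n σ = ∑ v ∈ Icc 1 n, (arcStep n (pval n σ) (pval n σ⁻¹) v).2.1 := by
  rw [drp, card_filter]
  rfl

/-- The number of `i ≤ p` at which a block of values at most `v` of the word `s` begins, a block
at position `1` not being counted. -/
def blockStarts (s : ℕ → ℕ) (v p : ℕ) : ℕ :=
  #{i ∈ Icc 1 p | v < s (i - 1) ∧ s i ≤ v}

/-- The descents of the word `s` straddling the value `v` and to the left of it. -/
def wordLes (n : ℕ) (s t : ℕ → ℕ) (v : ℕ) : ℕ :=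
  #{i ∈ Icc 1 n | i < t v ∧ v < s (i - 1) ∧ s i < v}

/-- The descents of the word `s` straddling the value `v` and to the right of it. -/
def wordRess (n : ℕ) (s t : ℕ → ℕ) (v : ℕ) : ℕ :=
  #{i ∈ Icc 1 n | t v < i ∧ i < n ∧ s (i + 1) < v ∧ v < s i}

/-- The step at `v` of the code of the word `s`. -/
def wordStep (n : ℕ) (s t : ℕ → ℕ) (v : ℕ) : ℕ × ℕ × ℕ :=
  (if v < s (t v - 1) then 1 else 0, if t v < n ∧ s (t v + 1) < v then 1 else 0,
    wordLes n s t v)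

namespace IsPermPair

variable {n : ℕ} {s t s' t' : ℕ → ℕ}

theorem blockStarts_succ (h : IsPermPair n s t) {v p : ℕ} (hv : v < n) (hp : p ≤ n) :
    blockStarts s (v + 1) p +
        (if t (v + 1) < p ∧ s (t (v + 1) + 1) < v + 1 then 1 else 0) =
      blockStarts s v p + (if t (v + 1) ≤ p ∧ v + 1 < s (t (v + 1) - 1) then 1 else 0) := by
  have ht := h.t_mem (v + 1) (by omega) hv
  have hst := h.s_t (v + 1) (by omega) hv
  have e₁ : (if t (v + 1) < p ∧ s (t (v + 1) + 1) < v + 1 then 1 else 0) =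
      ∑ i ∈ Icc 1 p, if i = t (v + 1) + 1 ∧ s (t (v + 1) + 1) < v + 1 then 1 else 0 := by
    simp only [sum_Icc_ite_eq_and (Nat.le_add_left 1 _), Nat.add_one_le_iff]
  rw [e₁, ← sum_Icc_ite_eq_and ht.1]
  simp only [blockStarts, card_filter, ← sum_add_distrib]
  refine sum_congr rfl fun i hi => ?_
  rw [mem_Icc] at hi
  have hts := h.t_s i hi.1 (by omega)
  have hts' : i - 1 = 0 ∨ t (s (i - 1)) = i - 1 := by
    rcases Nat.eq_zero_or_pos (i - 1) with h0 | h0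
    · exact Or.inl h0
    · exact Or.inr (h.t_s _ h0 (by omega))
  have hs0 := h.s_zero
  by_cases c₁ : i = t (v + 1)
  · subst c₁
    have : v + 1 ≠ s (t (v + 1) - 1) := by
      intro e
      rcases hts' with h0 | h0
      · rw [h0] at e; omega
      · rw [← e] at h0; omega
    split_ifs <;> omega
  · have hne : s i ≠ v + 1 := fun e => c₁ (by rw [← e, hts])
    by_cases c₂ : i = t (v + 1) + 1
    · subst c₂
      simp only [Nat.add_sub_cancel, hst, true_and]
      split_ifs <;> omega
    · have hne' : s (i - 1) ≠ v + 1 := by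
        intro e
        rcases hts' with h0 | h0
        · rw [h0] at e; omega
        · rw [e] at h0; omega
      split_ifs <;> omega

theorem wordLes_eq (h : IsPermPair n s t) {v : ℕ} (hv : v < n) :
    wordLes n s t (v + 1) = blockStarts s v (t (v + 1)) := by
  have ht := h.t_mem (v + 1) (by omega) hv
  have hst := h.s_t (v + 1) (by omega) hv
  have hs0 := h.s_zero
  rw [wordLes, blockStarts]
  congr 1
  ext i
  simp only [mem_filter, mem_Icc]
  constructor
  · rintro ⟨h₁, h₂, h₃, h₄⟩
    omega
  · rintro ⟨h₁, h₂, h₃⟩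
    have hne : i ≠ t (v + 1) := by rintro rfl; omega
    have hne' : s (i - 1) ≠ v + 1 := by
      intro e
      rcases Nat.eq_zero_or_pos (i - 1) with h0 | h0
      · rw [h0] at e; omega
      · have := h.t_s _ h0 (by omega)
        rw [e] at this
        omega
    omega

theorem wordRess_eq (h : IsPermPair n s t) {v : ℕ} (hv : v ≤ n) (hv' : 1 ≤ v) :
    wordRess n s t v = #{i ∈ Icc 1 n | t v + 1 < i ∧ s i < v ∧ v < s (i - 1)} := by
  refine card_nbij' (· + 1) (· - 1) ?_ ?_ ?_ ?_
  · intro i hi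
    simp only [coe_filter, mem_Icc, Set.mem_ofPred_eq, Nat.add_sub_cancel] at hi ⊢
    omega
  · intro i hi
    simp only [coe_filter, mem_Icc, Set.mem_ofPred_eq] at hi ⊢
    have := h.t_mem v hv' hv
    rw [Nat.sub_add_cancel (by omega)]
    omega
  · intro i hi
    simp
  · intro i hi
    simp only [coe_filter, mem_Icc, Set.mem_ofPred_eq] at hi ⊢
    omega

theorem word_slack (h : IsPermPair n s t) {v : ℕ} (hv : v < n) :
    wordLes n s t (v + 1) + wordRess n s t (v + 1) +
        (if t (v + 1) < n ∧ s (t (v + 1) + 1) < v + 1 then 1 else 0) =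
      blockStarts s v n := by
  have ht := h.t_mem (v + 1) (by omega) hv
  have hst := h.s_t (v + 1) (by omega) hv
  have hs0 := h.s_zero
  have e₁ : (if t (v + 1) < n ∧ s (t (v + 1) + 1) < v + 1 then 1 else 0) =
      ∑ i ∈ Icc 1 n, if i = t (v + 1) + 1 ∧ s (t (v + 1) + 1) < v + 1 then 1 else 0 := by
    simp only [sum_Icc_ite_eq_and (Nat.le_add_left 1 _), Nat.add_one_le_iff]
  rw [h.wordRess_eq (v := v + 1) hv (by omega), e₁, wordLes, blockStarts]
  simp only [card_filter, ← sum_add_distrib]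
  refine sum_congr rfl fun i hi => ?_
  rw [mem_Icc] at hi
  by_cases c₁ : i = t (v + 1)
  · subst c₁
    split_ifs <;> omega
  · by_cases c₂ : i = t (v + 1) + 1
    · subst c₂
      simp only [Nat.add_sub_cancel, hst, true_and]
      split_ifs <;> omega
    · have hne' : s (i - 1) ≠ v + 1 := by
        intro e
        rcases Nat.eq_zero_or_pos (i - 1) with h0 | h0
        · rw [h0] at e; omega
        · have := h.t_s _ h0 (by omega)
          rw [e] at this
          omega
      split_ifs <;> omega

theorem isCode_wordStep (h : IsPermPair n s t) :
    IsCode n (wordStep n s t) (wordRess n s t) (fun v => blockStarts s v n) where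
  zero := by
    rw [blockStarts, card_eq_zero, filter_eq_empty_iff]
    intro i hi
    rw [mem_Icc] at hi
    have := h.s_mem i hi.1 hi.2
    omega
  last := by
    rw [blockStarts, card_eq_zero, filter_eq_empty_iff]
    intro i hi
    rw [mem_Icc] at hi
    have := h.s_zero
    rcases Nat.eq_zero_or_pos (i - 1) with h0 | h0
    · rw [h0]; omega
    · have := h.s_mem (i - 1) h0 (by omega)
      omega
  fst_le v := by rw [wordStep]; dsimp only; split_ifs <;> omega
  snd_le v := by rw [wordStep]; dsimp only; split_ifs <;> omega
  height v hv := by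
    have := h.blockStarts_succ hv le_rfl
    have ht := h.t_mem (v + 1) (by omega) hv
    simpa [wordStep, ht] using this
  slack v hv := h.word_slack hv

theorem blockStarts_mono {v p q : ℕ} (hpq : p ≤ q) : blockStarts s v p ≤ blockStarts s v q :=
  card_le_card (filter_subset_filter _ (Icc_subset_Icc_right hpq))

theorem blockStarts_lt {v p q : ℕ} (hpq : p < q) (hp : v < s p) (hq : s q ≤ v) :
    blockStarts s v p < blockStarts s v q := by
  classical
  have hex : ∃ i, p < i ∧ s i ≤ v := ⟨q, hpq, hq⟩
  obtain ⟨h₁, h₂⟩ := Nat.find_spec hex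
  have h₃ : Nat.find hex ≤ q := Nat.find_min' hex ⟨hpq, hq⟩
  have h₄ : v < s (Nat.find hex - 1) := by
    have := Nat.find_min hex (m := Nat.find hex - 1) (by omega)
    rcases Nat.lt_or_ge p (Nat.find hex - 1) with hl | hl
    · by_contra hc
      exact this ⟨hl, by omega⟩
    · rwa [show Nat.find hex - 1 = p by omega]
  refine card_lt_card ?_
  rw [ssubset_iff_of_subset (filter_subset_filter _ (Icc_subset_Icc_right hpq.le))]
  refine ⟨Nat.find hex, ?_, ?_⟩
  · simp only [mem_filter, mem_Icc]
    omega
  · simp only [mem_filter, mem_Icc]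
    omega

/-- The code determines whether a smaller value lies to the left of the value `v + 1`. -/
theorem t_lt_iff (h : IsPermPair n s t) {u v : ℕ} (hu : 1 ≤ u) (huv : u ≤ v) (hv : v < n) :
    t u < t (v + 1) ↔ blockStarts s v (t u) ≤ wordLes n s t (v + 1) := by
  rw [h.wordLes_eq hv]
  refine ⟨fun hlt => blockStarts_mono hlt.le, fun hle => ?_⟩
  by_contra hge
  have hne := h.t_ne_of_ne hu (by omega) (by omega : 1 ≤ v + 1) (by omega) (by omega)
  have := blockStarts_lt (s := s) (v := v) (p := t (v + 1)) (q := t u) (by omega)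
    (by rw [h.s_t _ (by omega) hv]; omega) (by rw [h.s_t _ hu (by omega)]; exact huv)
  omega

theorem eq_of_lt_iff_lt (h : IsPermPair n s t) (h' : IsPermPair n s' t')
    (hlt : ∀ u u', 1 ≤ u → u ≤ n → 1 ≤ u' → u' ≤ n → (t u < t u' ↔ t' u < t' u')) {u : ℕ}
    (h₁ : 1 ≤ u) (h₂ : u ≤ n) : t u = t' u := by
  rw [← h.symm.card_filter_le (h.t_mem u h₁ h₂).2, ← h'.symm.card_filter_le (h'.t_mem u h₁ h₂).2]
  congr 1
  refine filter_congr fun x hx => ?_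
  rw [mem_Icc] at hx
  have := hlt u x h₁ h₂ hx.1 hx.2
  omega

theorem eq_of_wordStep_eq (h : IsPermPair n s t) (h' : IsPermPair n s' t')
    (hx : ∀ v, 1 ≤ v → v ≤ n → wordStep n s t v = wordStep n s' t' v) {v : ℕ} (hv : 1 ≤ v)
    (hv' : v ≤ n) : t v = t' v := by
  have key : ∀ m, m ≤ n → ∀ u, 1 ≤ u → u ≤ m →
      blockStarts s m (t u) = blockStarts s' m (t' u) ∧
        ∀ u', 1 ≤ u' → u' ≤ m → (t u < t u' ↔ t' u < t' u') := by
    intro m hm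
    induction m with
    | zero => intro u h₁ h₂; omega
    | succ m ih =>
      have ih := ih (by omega)
      have hstep := hx (m + 1) (by omega) hm
      have ha := congrArg (fun x => x.1) hstep
      have hd := congrArg (fun x => x.2.1) hstep
      have hc := congrArg (fun x => x.2.2) hstep
      simp only [wordStep] at ha hd hc
      have hord : ∀ u, 1 ≤ u → u ≤ m → (t u < t (m + 1) ↔ t' u < t' (m + 1)) := by
        intro u h₁ h₂
        rw [h.t_lt_iff h₁ h₂ hm, h'.t_lt_iff h₁ h₂ hm, (ih u h₁ h₂).1, hc]
      have hne : ∀ u, 1 ≤ u → u ≤ m → t u ≠ t (m + 1) ∧ t' u ≠ t' (m + 1) := fun u h₁ h₂ =>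
        ⟨h.t_ne_of_ne h₁ (by omega) (by omega) hm (by omega),
          h'.t_ne_of_ne h₁ (by omega) (by omega) hm (by omega)⟩
      intro u h₁ h₂
      refine ⟨?_, ?_⟩
      · have htu := h.t_mem u h₁ (by omega)
        have htu' := h'.t_mem u h₁ (by omega)
        have e₁ := h.blockStarts_succ hm htu.2
        have e₂ := h'.blockStarts_succ hm htu'.2
        rcases Nat.lt_or_ge m u with hmu | hmu
        · obtain rfl : u = m + 1 := by omega
          rw [h.wordLes_eq hm, h'.wordLes_eq hm] at hc
          split_ifs at * <;> omega
        · have hb := (ih u h₁ hmu).1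
          have ho := hord u h₁ hmu
          have hn := hne u h₁ hmu
          split_ifs at * <;> omega
      · intro u' h₁' h₂'
        rcases Nat.lt_or_ge m u with hmu | hmu <;> rcases Nat.lt_or_ge m u' with hmu' | hmu'
        · obtain rfl : u = u' := by omega
          simp
        · obtain rfl : u = m + 1 := by omega
          have ho := hord u' h₁' hmu'
          have hn := hne u' h₁' hmu'
          omega
        · obtain rfl : u' = m + 1 := by omega
          exact hord u h₁ hmu
        · exact (ih u h₁ hmu).2 u' h₁' hmu'
  exact h.eq_of_lt_iff_lt h'
    (fun u u' h₁ h₂ h₁' h₂' => (key n le_rfl u h₁ h₂).2 u' h₁' h₂') hv hv'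

end IsPermPair

theorem les_eq_sum (n : ℕ) (σ : Equiv.Perm (Fin n)) :
    les n σ = ∑ v ∈ Icc 1 n, (wordStep n (pval n σ) (pval n σ⁻¹) v).2.2 := by
  have h := isPermPair_pval σ
  have e : les n σ = #{p ∈ Icc 1 n ×ˢ Icc 1 n | p.1 < p.2 ∧
      pval n σ p.2 < pval n σ (p.1 - 1) ∧ pval n σ p.1 < pval n σ p.2} := by
    rw [les]
    congr 1
    ext ⟨i, j⟩
    simp only [mem_filter, mem_product, mem_Icc]
    have hs0 := h.s_zero
    refine ⟨fun _ => by omega, fun hij => ?_⟩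
    have : i ≠ 1 := by
      rintro rfl
      simp only [Nat.sub_self] at hij
      omega
    omega
  rw [e, card_filter, sum_product_right, h.sum_comp]
  refine sum_congr rfl fun v hv => ?_
  rw [mem_Icc] at hv
  rw [← card_filter]
  simp only [h.s_t v hv.1 hv.2, wordStep, wordLes]

theorem ress_eq_sum (n : ℕ) (σ : Equiv.Perm (Fin n)) :
    ress n σ = ∑ v ∈ Icc 1 n, wordRess n (pval n σ) (pval n σ⁻¹) v := by
  have h := isPermPair_pval σ
  have e : ress n σ = #{p ∈ Icc 1 n ×ˢ Icc 1 n | p.1 < p.2 ∧ p.2 < n ∧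
      pval n σ (p.2 + 1) < pval n σ p.1 ∧ pval n σ p.1 < pval n σ p.2} := by
    rw [ress]
    congr 1
    ext ⟨i, j⟩
    simp only [mem_filter, mem_product, mem_Icc]
    omega
  rw [e, card_filter, sum_product, h.sum_comp]
  refine sum_congr rfl fun v hv => ?_
  rw [mem_Icc] at hv
  rw [← card_filter]
  simp only [h.s_t v hv.1 hv.2, wordRess]

theorem des_eq_sum (n : ℕ) (σ : Equiv.Perm (Fin n)) :
    des n σ = ∑ v ∈ Icc 1 n, (wordStep n (pval n σ) (pval n σ⁻¹) v).2.1 := by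
  have h := isPermPair_pval σ
  have e : des n σ = #{i ∈ Icc 1 n | i < n ∧ pval n σ (i + 1) < pval n σ i} := by
    rw [des]
    congr 1
    ext i
    simp only [mem_filter, mem_Icc]
    omega
  rw [e, card_filter, h.sum_comp]
  refine sum_congr rfl fun v hv => ?_
  rw [mem_Icc] at hv
  simp only [h.s_t v hv.1 hv.2, wordStep]

/-- There is a bijection `Φ` on `S_n` with
`(nest, cros, drop) σ = (ress, les, des) Φ(σ)` for all `σ`. -/
theorem statement5 (n : ℕ) (hn : 0 < n) :
    ∃ Φ : Equiv.Perm (Fin n) ≃ Equiv.Perm (Fin n),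
      ∀ σ : Equiv.Perm (Fin n),
        nest n σ = ress n (Φ σ) ∧ cros n σ = les n (Φ σ) ∧ drp n σ = des n (Φ σ) := by
  obtain ⟨Φ, hΦ⟩ := exists_equiv_of_codes
    (fun σ : Equiv.Perm (Fin n) => (isPermPair_pval σ).isCode_arcStep)
    (fun σ => (isPermPair_pval σ).isCode_wordStep)
    (fun σ τ hx => perm_ext_of_pval_inv fun v h₁ h₂ =>
      (isPermPair_pval σ).eq_of_arcStep_eq (isPermPair_pval τ) hx h₁ h₂)
    (fun σ τ hx => perm_ext_of_pval_inv fun v h₁ h₂ =>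
      (isPermPair_pval σ).eq_of_wordStep_eq (isPermPair_pval τ) hx h₁ h₂)
  refine ⟨Φ, fun σ => ⟨?_, ?_, ?_⟩⟩
  · rw [nest_eq_sum, ress_eq_sum]
    exact sum_congr rfl fun v hv => (hΦ σ v (mem_Icc.1 hv).1 (mem_Icc.1 hv).2).2
  · rw [cros_eq_sum, les_eq_sum]
    exact sum_congr rfl fun v hv => by rw [(hΦ σ v (mem_Icc.1 hv).1 (mem_Icc.1 hv).2).1]
  · rw [drp_eq_sum, des_eq_sum]
    exact sum_congr rfl fun v hv => by rw [(hΦ σ v (mem_Icc.1 hv).1 (mem_Icc.1 hv).2).1]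
end

section
/- For every positive integer n, the triple of statistics (ress, les, des) is equidistributed with the triple (res, les, des) on S_n; that is, Σ_{σ ∈ S_n} p^{ress σ} q^{les σ} t^{des σ} = Σ_{σ ∈ S_n} p^{res σ} q^{les σ} t^{des σ} as polynomials in p, q, t. -/
open Finset MvPolynomial

section GapLists

variable {K : Type*} [CommRing K]

/-- The sum of `F a b` over all `a b` with `a + b + 1 = c`. -/
def splitNat (F : ℕ → ℕ → K) : ℕ → K
  | 0 => 0
  | c + 1 => ∑ x ∈ antidiagonal c, F x.1 x.2

/-- The sum over all ways to split an entry `c` of a list `L ++ c :: R` as `a + 1 + b`. -/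
def gapSum (f : List ℕ → ℕ → ℕ → List ℕ → K) : List ℕ → K
  | [] => 0
  | c :: g => splitNat (fun a b => f [] a b g) c + gapSum (fun L a b R => f (c :: L) a b R) g

/-- The sum of `F` over the compositions of `N` into `l` positive parts. -/
def compSum : ℕ → ℕ → (List ℕ → K) → K
  | 0, N, F => if N = 0 then F [] else 0
  | l + 1, N, F => splitNat (fun c d => compSum l d (fun g => F ((c + 1) :: g))) N

/-- The nonzero entries of a list. -/
def nonzeros (g : List ℕ) : List ℕ := g.filter (· ≠ 0)

lemma splitNat_add (F G : ℕ → ℕ → K) (c : ℕ) :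
    splitNat (fun a b => F a b + G a b) c = splitNat F c + splitNat G c := by
  cases c <;> simp [splitNat, Finset.sum_add_distrib]

lemma splitNat_const_mul (k : K) (F : ℕ → ℕ → K) (c : ℕ) :
    splitNat (fun a b => k * F a b) c = k * splitNat F c := by
  cases c <;> simp [splitNat, Finset.mul_sum]

lemma splitNat_sum {ι : Type*} (s : Finset ι) (F : ι → ℕ → ℕ → K) (c : ℕ) :
    splitNat (fun a b => ∑ i ∈ s, F i a b) c = ∑ i ∈ s, splitNat (F i) c := by
  cases c with
  | zero => simp [splitNat]
  | succ c => exact Finset.sum_comm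

lemma sum_antidiagonal_eq_add_splitNat (F : ℕ → ℕ → K) (N : ℕ) :
    ∑ x ∈ antidiagonal N, F x.1 x.2 = F 0 N + splitNat (fun a b => F (a + 1) b) N := by
  cases N with
  | zero => simp [splitNat]
  | succ N => rw [Finset.Nat.sum_antidiagonal_succ]; rfl

lemma sum_antidiagonal_eq_splitNat (F : ℕ → ℕ → K) (h : ∀ c, F c 0 = 0) (N : ℕ) :
    ∑ x ∈ antidiagonal N, F x.1 x.2 = splitNat (fun a b => F a (b + 1)) N := by
  cases N with
  | zero => simp [splitNat, h]
  | succ N => rw [Finset.Nat.sum_antidiagonal_succ', h, zero_add]; rfl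

lemma compSum_add (l N : ℕ) (F G : List ℕ → K) :
    compSum l N (fun g => F g + G g) = compSum l N F + compSum l N G := by
  induction l generalizing N F G with
  | zero => by_cases h : N = 0 <;> simp [compSum, h]
  | succ l ih => simp only [compSum, ih, splitNat_add]

lemma compSum_const_mul (l N : ℕ) (k : K) (F : List ℕ → K) :
    compSum l N (fun g => k * F g) = k * compSum l N F := by
  induction l generalizing N F with
  | zero => by_cases h : N = 0 <;> simp [compSum, h]
  | succ l ih => simp only [compSum, ih, splitNat_const_mul]

lemma compSum_zero_fun (l N : ℕ) : compSum l N (fun _ => (0 : K)) = 0 := by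
  simpa using compSum_const_mul l N (0 : K) (fun _ => 0)

lemma compSum_sum {ι : Type*} (s : Finset ι) (l N : ℕ) (F : ι → List ℕ → K) :
    compSum l N (fun g => ∑ i ∈ s, F i g) = ∑ i ∈ s, compSum l N (F i) := by
  classical
  induction s using Finset.induction_on with
  | empty => simp [compSum_zero_fun]
  | insert a s ha ih => simp only [Finset.sum_insert ha, compSum_add, ih]

lemma compSum_congr {l N : ℕ} {F G : List ℕ → K} (h : ∀ g, g.length = l → F g = G g) :
    compSum l N F = compSum l N G := by
  induction l generalizing N F G with
  | zero => simp [compSum, h [] rfl]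
  | succ l ih =>
    simp only [compSum]
    congr 1
    ext c d
    exact ih fun g hg => h _ (by simp [hg])

lemma compSum_one (N : ℕ) (F : List ℕ → K) : compSum 1 (N + 1) F = F [N + 1] := by
  simp only [compSum, splitNat]
  rw [Finset.sum_eq_single (N, 0)]
  · simp
  · rintro ⟨c, d⟩ h1 h2
    have h3 : d ≠ 0 := by
      rintro rfl
      simp_all
    simp [h3]
  · simp

lemma nonzeros_append (g h : List ℕ) : nonzeros (g ++ h) = nonzeros g ++ nonzeros h := by
  simp [nonzeros]

/-- Summing over all splittings of the first part. -/
lemma compSum_split_head (l N : ℕ) (α β : K) (F : List ℕ → K) :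
    ∑ x ∈ antidiagonal N, compSum l x.2 (fun g => ∑ y ∈ antidiagonal x.1,
        (if y.2 = 0 then β else α) * F (nonzeros [y.1, y.2] ++ g)) =
      α * (compSum (l + 2) N F + compSum (l + 1) N F) +
        β * (compSum (l + 1) N F + compSum l N F) := by
  have tail (M : ℕ) (H : List ℕ → K) :
      ∑ z ∈ antidiagonal M, (if z.1 = 0 then β else α) *
          compSum l z.2 (fun g => H (nonzeros [z.1] ++ g)) =
        β * compSum l M H + α * compSum (l + 1) M H := by
    rw [sum_antidiagonal_eq_add_splitNat (fun b d => (if b = 0 then β else α) *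
      compSum l d (fun g => H (nonzeros [b] ++ g)))]
    simp [nonzeros, compSum, splitNat_const_mul]
  have assoc : ∀ G : ℕ → ℕ → ℕ → K,
      ∑ x ∈ antidiagonal N, ∑ y ∈ antidiagonal x.1, G y.1 y.2 x.2 =
        ∑ x ∈ antidiagonal N, ∑ z ∈ antidiagonal x.2, G x.1 z.1 z.2 := fun G => by
    rw [Finset.sum_sigma', Finset.sum_sigma']
    exact Finset.sum_nbij' (fun x => ⟨(x.2.1, x.2.2 + x.1.2), (x.2.2, x.1.2)⟩)
      (fun x => ⟨(x.1.1 + x.2.1, x.2.2), (x.1.1, x.2.1)⟩)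
      (by rintro ⟨⟨a, b⟩, c, d⟩ h; simp at h ⊢; omega)
      (by rintro ⟨⟨a, b⟩, c, d⟩ h; simp at h ⊢; omega)
      (by rintro ⟨⟨a, b⟩, c, d⟩ h; simp at h ⊢; omega)
      (by rintro ⟨⟨a, b⟩, c, d⟩ h; simp at h ⊢; omega)
      (by rintro ⟨⟨a, b⟩, c, d⟩ h; simp)
  simp only [compSum_sum, compSum_const_mul]
  rw [assoc (fun a b d => (if b = 0 then β else α) *
    compSum l d (fun g => F (nonzeros [a, b] ++ g)))]
  have key (a M : ℕ) : ∑ z ∈ antidiagonal M, (if z.1 = 0 then β else α) *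
      compSum l z.2 (fun g => F (nonzeros [a, z.1] ++ g)) =
        β * compSum l M (fun g => F (nonzeros [a] ++ g)) +
          α * compSum (l + 1) M (fun g => F (nonzeros [a] ++ g)) := by
    rw [← tail M (fun g => F (nonzeros [a] ++ g))]
    refine Finset.sum_congr rfl fun z _ => ?_
    simp only [← List.append_assoc, ← nonzeros_append, List.cons_append, List.nil_append]
  simp only [key]
  rw [sum_antidiagonal_eq_add_splitNat (fun a M =>
    β * compSum l M (fun g => F (nonzeros [a] ++ g)) +
          α * compSum (l + 1) M (fun g => F (nonzeros [a] ++ g)))]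
  have h1 (l' : ℕ) : splitNat (fun a b =>
      compSum l' b fun g => F (nonzeros [a + 1] ++ g)) N = compSum (l' + 1) N F := by
    simp [nonzeros, compSum]
  rw [splitNat_add, splitNat_const_mul, splitNat_const_mul, h1, h1]
  simp only [nonzeros, List.filter_cons, List.filter_nil]
  simp
  ring

lemma compSum_succ_succ (l N : ℕ) (F : List ℕ → K) :
    compSum (l + 1) (N + 1) F =
      ∑ x ∈ antidiagonal N, compSum l x.2 (fun g => F ((x.1 + 1) :: g)) := rfl

lemma compSum_gapSum_eq_head_add_tail (l N : ℕ) (α β : ℕ → ℕ → K) (F : List ℕ → K) :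
    compSum (l + 1) (N + 1) (gapSum fun L a b R =>
        (if b = 0 then β L.length R.length else α L.length R.length) *
          F (L ++ nonzeros [a, b] ++ R)) =
      α 0 l * (compSum (l + 2) N F + compSum (l + 1) N F) +
        β 0 l * (compSum (l + 1) N F + compSum l N F) +
      ∑ x ∈ antidiagonal N, compSum l x.2 (gapSum fun L a b R =>
        (if b = 0 then β (L.length + 1) R.length else α (L.length + 1) R.length) *
          F ((x.1 + 1) :: (L ++ nonzeros [a, b] ++ R))) := by
  rw [← compSum_split_head, compSum_succ_succ, ← Finset.sum_add_distrib]
  refine Finset.sum_congr rfl fun x _ => ?_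
  rw [← compSum_add]
  refine compSum_congr fun g hg => ?_
  simp [gapSum, splitNat, hg]

/-- Splitting a part in all compositions at once. -/
lemma compSum_gapSum (l N : ℕ) (α β : ℕ → ℕ → K) (F : List ℕ → K) :
    compSum (l + 1) (N + 1) (gapSum fun L a b R =>
        (if b = 0 then β L.length R.length else α L.length R.length) *
          F (L ++ nonzeros [a, b] ++ R)) =
      ∑ i ∈ Finset.range (l + 1),
        (α i (l - i) * (compSum (l + 2) N F + compSum (l + 1) N F) +
          β i (l - i) * (compSum (l + 1) N F + compSum l N F)) := by
  induction l generalizing N α β F with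
  | zero =>
    rw [compSum_gapSum_eq_head_add_tail]
    simp [gapSum, compSum]
  | succ l ih =>
    rw [compSum_gapSum_eq_head_add_tail, Finset.sum_range_succ', add_comm,
      sum_antidiagonal_eq_splitNat (fun c d => compSum (l + 1) d (gapSum fun L a b R =>
        (if b = 0 then β (L.length + 1) R.length else α (L.length + 1) R.length) *
          F ((c + 1) :: (L ++ nonzeros [a, b] ++ R)))) (fun c => by simp [compSum, splitNat])]
    congr 1
    have := fun c d => ih d (fun i j => α (i + 1) j) (fun i j => β (i + 1) j)
      (fun g => F ((c + 1) :: g))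
    simp only [this, splitNat_sum, splitNat_add, splitNat_const_mul]
    refine Finset.sum_congr rfl fun i _ => ?_
    simp only [Nat.add_sub_add_right]
    rfl

end GapLists

section GapWeights

variable {K : Type*} [CommRing K]

/-- The weighted number of ways to fill `m` cells one at a time, starting from the gaps `g`. -/
def gapWeight (α β : ℕ → ℕ → K) : ℕ → List ℕ → K
  | 0, _ => 1
  | m + 1, g => gapSum (fun L a b R =>
      (if b = 0 then β L.length R.length else α L.length R.length) *
        gapWeight α β m (L ++ nonzeros [a, b] ++ R)) g

lemma compSum_gapWeight_succ (α β : ℕ → ℕ → K) (m l N : ℕ) :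
    compSum (l + 1) (N + 1) (gapWeight α β (m + 1)) =
      (∑ i ∈ Finset.range (l + 1), α i (l - i)) *
          (compSum (l + 2) N (gapWeight α β m) + compSum (l + 1) N (gapWeight α β m)) +
        (∑ i ∈ Finset.range (l + 1), β i (l - i)) *
          (compSum (l + 1) N (gapWeight α β m) + compSum l N (gapWeight α β m)) := by
  rw [Finset.sum_mul, Finset.sum_mul, ← Finset.sum_add_distrib, ← compSum_gapSum]
  rfl

/-- The two-parameter analogue of the integer `l`. -/
def pqInt (p q : K) (l : ℕ) : K := ∑ i ∈ Finset.range l, q ^ i * p ^ (l - 1 - i)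

variable (p q t : K)

/-- Filling weights when the last gap is unbounded on the right. -/
def openWeight (i j : ℕ) : K := if j = 0 then 0 else t * q ^ i * p ^ (j - 1)

lemma sum_openWeight (l : ℕ) :
    ∑ i ∈ Finset.range (l + 1), openWeight p q t i (l - i) = t * pqInt p q l := by
  rw [Finset.sum_range_succ, pqInt, Finset.mul_sum]
  simp only [openWeight, Nat.sub_self, if_true, add_zero]
  refine Finset.sum_congr rfl fun i hi => ?_
  have := Finset.mem_range.1 hi
  rw [if_neg (by omega), show l - i - 1 = l - 1 - i by omega, mul_assoc]

lemma compSum_openWeight_succ (m l N : ℕ) :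
    compSum (l + 1) (N + 1) (gapWeight (fun i j => q ^ i * p ^ j) (openWeight p q t) (m + 1)) =
      pqInt p q (l + 1) *
        (compSum (l + 2) N (gapWeight (fun i j => q ^ i * p ^ j) (openWeight p q t) m) +
          compSum (l + 1) N (gapWeight (fun i j => q ^ i * p ^ j) (openWeight p q t) m)) +
      t * pqInt p q l *
        (compSum (l + 1) N (gapWeight (fun i j => q ^ i * p ^ j) (openWeight p q t) m) +
          compSum l N (gapWeight (fun i j => q ^ i * p ^ j) (openWeight p q t) m)) := by
  rw [compSum_gapWeight_succ, sum_openWeight]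
  rfl

lemma compSum_closedWeight_succ (m l N : ℕ) :
    compSum (l + 1) (N + 1) (gapWeight (fun i j => q ^ i * p ^ j)
        (fun i j => t * q ^ i * p ^ j) (m + 1)) =
      pqInt p q (l + 1) *
        (compSum (l + 2) N (gapWeight (fun i j => q ^ i * p ^ j)
            (fun i j => t * q ^ i * p ^ j) m) +
          (1 + t) * compSum (l + 1) N (gapWeight (fun i j => q ^ i * p ^ j)
            (fun i j => t * q ^ i * p ^ j) m) +
          t * compSum l N (gapWeight (fun i j => q ^ i * p ^ j)
            (fun i j => t * q ^ i * p ^ j) m)) := by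
  rw [compSum_gapWeight_succ]
  simp only [mul_assoc, ← Finset.mul_sum]
  simp only [pqInt, Nat.add_sub_cancel]
  ring

lemma compSum_closedWeight_eq (m l : ℕ) :
    compSum l (m + 1) (gapWeight (fun i j => q ^ i * p ^ j)
        (fun i j => t * q ^ i * p ^ j) (m + 1)) =
      t * pqInt p q l *
        (compSum (l + 1) (m + 1) (gapWeight (fun i j => q ^ i * p ^ j) (openWeight p q t) m) +
          compSum l (m + 1) (gapWeight (fun i j => q ^ i * p ^ j) (openWeight p q t) m)) := by
  induction m generalizing l with
  | zero =>
    match l with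
    | 0 => simp [pqInt, compSum]
    | 1 =>
      rw [compSum_closedWeight_succ]
      simp [pqInt, compSum, splitNat, gapWeight, Finset.filter_singleton]
    | l + 2 =>
      rw [compSum_closedWeight_succ]
      simp [pqInt, compSum, splitNat, gapWeight]
  | succ m ih =>
    match l with
    | 0 => simp [pqInt, compSum]
    | l + 1 =>
      rw [compSum_closedWeight_succ, ih, ih, ih, compSum_openWeight_succ, compSum_openWeight_succ]
      ring

lemma gapWeight_closed_eq_mul_open (n : ℕ) (hn : 0 < n) :
    gapWeight (fun i j => q ^ i * p ^ j) (fun i j => t * q ^ i * p ^ j) n [n] =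
      t * gapWeight (fun i j => q ^ i * p ^ j) (openWeight p q t) n [n + 1] := by
  obtain ⟨m, rfl⟩ := Nat.exists_eq_succ_of_ne_zero hn.ne'
  rw [Nat.succ_eq_add_one, ← compSum_one m (gapWeight _ _ _),
    ← compSum_one (m + 1) (gapWeight _ _ _), compSum_closedWeight_eq, compSum_openWeight_succ]
  simp [pqInt]

end GapWeights

section FillWords

variable {K : Type*} [CommRing K]

/-- The sum of `f u v` over all ways to write a list as `u ++ false :: v`. -/
def cellSum (f : List Bool → List Bool → K) : List Bool → K
  | [] => 0
  | x :: l => (if x then 0 else f [] l) + cellSum (fun u v => f (x :: u) v) l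

/-- The weighted number of ways to fill `m` empty (`false`) cells of a word one at a time. -/
def fillWeight (w : List Bool → List Bool → K) : ℕ → List Bool → K
  | 0, _ => 1
  | m + 1, l => cellSum (fun u v => w u v * fillWeight w m (u ++ true :: v)) l

/-- The word with given gaps between filled cells, ending with a filled cell. -/
def gapWord (g : List ℕ) : List Bool := g.flatMap fun c => List.replicate c false ++ [true]

@[simp] lemma gapWord_nil : gapWord [] = [] := rfl

@[simp] lemma gapWord_cons (c : ℕ) (g : List ℕ) :
    gapWord (c :: g) = List.replicate c false ++ true :: gapWord g := by
  simp [gapWord]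

@[simp] lemma gapWord_append (g h : List ℕ) : gapWord (g ++ h) = gapWord g ++ gapWord h := by
  simp [gapWord]

lemma splitNat_succ (F : ℕ → ℕ → K) (c : ℕ) :
    splitNat F (c + 1) = F 0 c + splitNat (fun a b => F (a + 1) b) c :=
  sum_antidiagonal_eq_add_splitNat F c

lemma cellSum_replicate_append (f : List Bool → List Bool → K) (c : ℕ) (l : List Bool) :
    cellSum f (List.replicate c false ++ l) =
      splitNat (fun a b => f (List.replicate a false) (List.replicate b false ++ l)) c +
        cellSum (fun u v => f (List.replicate c false ++ u) v) l := by
  induction c generalizing f with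
  | zero => simp [splitNat]
  | succ c ih => simp [List.replicate_succ, cellSum, splitNat_succ, ih, add_assoc]

lemma cellSum_gapWord (f : List Bool → List Bool → K) (g : List ℕ) :
    cellSum f (gapWord g) = gapSum (fun L a b R =>
      f (gapWord L ++ List.replicate a false)
        (List.replicate b false ++ true :: gapWord R)) g := by
  induction g generalizing f with
  | nil => rfl
  | cons c g ih =>
    simp [gapSum, cellSum_replicate_append, cellSum, ih]

lemma gapSum_nonzeros {f F : List ℕ → ℕ → ℕ → List ℕ → K}
    (h : ∀ L a b R, f L a b R = F (nonzeros L) a b (nonzeros R)) (g : List ℕ) :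
    gapSum f g = gapSum F (nonzeros g) := by
  induction g generalizing f F with
  | nil => rfl
  | cons c g ih =>
    cases c with
    | zero =>
      simp only [gapSum, splitNat, zero_add]
      exact ih fun L a b R => h _ _ _ _
    | succ c =>
      simp only [gapSum, nonzeros, splitNat]
      simp only [ne_eq, Nat.add_eq_zero_iff, one_ne_zero, and_false, not_false_eq_true,
        decide_true, List.filter_cons_of_pos, gapSum, splitNat]
      congr 1
      · simp [h, nonzeros]
      · exact ih fun L a b R => h _ _ _ _

lemma fillWeight_gapWord {w : List Bool → List Bool → K} {α β : ℕ → ℕ → K}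
    (hw : ∀ L a b R, w (gapWord L ++ List.replicate a false)
      (List.replicate b false ++ true :: gapWord R) =
        if b = 0 then β (nonzeros L).length (nonzeros R).length
        else α (nonzeros L).length (nonzeros R).length) (m : ℕ) (g : List ℕ) :
    fillWeight w m (gapWord g) = gapWeight α β m (nonzeros g) := by
  induction m generalizing g with
  | zero => rfl
  | succ m ih =>
    rw [fillWeight, gapWeight, cellSum_gapWord]
    refine gapSum_nonzeros (fun L a b R => ?_) g
    rw [hw, ← nonzeros_append, ← nonzeros_append, ← ih]
    simp

/-- The number of occurrences of the factor `a b` in a word. -/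
def countFactor (a b : Bool) : List Bool → ℕ
  | x :: y :: l => (if x = a ∧ y = b then 1 else 0) + countFactor a b (y :: l)
  | _ => 0

lemma countFactor_false_true_cons_true (l : List Bool) :
    countFactor false true (true :: l) = countFactor false true l := by
  cases l <;> simp [countFactor]

lemma countFactor_false_true_replicate_append (c : ℕ) (l : List Bool) :
    countFactor false true (List.replicate c false ++ true :: l) =
      (if c = 0 then 0 else 1) + countFactor false true l := by
  induction c with
  | zero => simp [countFactor_false_true_cons_true]
  | succ c ih =>
    cases c with
    | zero => simp [countFactor, countFactor_false_true_cons_true]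
    | succ c => simpa [List.replicate_succ, countFactor] using ih

lemma countFactor_replicate (a : ℕ) :
    countFactor false true (List.replicate a false) = 0 := by
  induction a with
  | zero => rfl
  | succ a ih => cases a <;> simp_all [List.replicate_succ, countFactor]

lemma length_nonzeros_cons (c : ℕ) (g : List ℕ) :
    (nonzeros (c :: g)).length = (if c = 0 then 0 else 1) + (nonzeros g).length := by
  by_cases h : c = 0 <;> simp [nonzeros, h, add_comm]

lemma countFactor_false_true_gapWord_append (g : List ℕ) (l : List Bool) :
    countFactor false true (gapWord g ++ l) =
      (nonzeros g).length + countFactor false true l := by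
  induction g with
  | nil => simp [nonzeros]
  | cons c g ih =>
    simp [countFactor_false_true_replicate_append, ih, length_nonzeros_cons, add_assoc]

lemma countFactor_true_false_replicate_append (c : ℕ) (l : List Bool) :
    countFactor true false (List.replicate c false ++ true :: l) =
      countFactor true false (true :: l) := by
  induction c with
  | zero => simp
  | succ c ih => cases c <;> simp_all [List.replicate_succ, countFactor]

lemma countFactor_true_false_gapWord (g : List ℕ) :
    countFactor true false (true :: gapWord g) = (nonzeros g).length := by
  induction g with
  | nil => rfl
  | cons c g ih =>
    rw [length_nonzeros_cons, ← ih, gapWord_cons]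
    cases c with
    | zero => simp [countFactor]
    | succ c =>
      have := countFactor_true_false_replicate_append (c + 1) (gapWord g)
      simp_all [List.replicate_succ, countFactor]

variable (p q t : K)

/-- Weight of filling a cell of a word that ends with an unfillable empty cell
followed by a filled one. -/
def openCellWeight (u v : List Bool) : K :=
  if countFactor false true v = 0 then 0 else
    q ^ countFactor false true u * p ^ (countFactor false true v - 1) *
      (if v.head? = some true then t else 1)

/-- Weight of filling a cell of a word that ends with a filled cell. -/
def closedCellWeight (u v : List Bool) : K :=
  q ^ countFactor false true u * p ^ countFactor true false v *
    (if v.head? = some true then t else 1)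

lemma countFactor_gapWord_append_replicate (L : List ℕ) (a : ℕ) :
    countFactor false true (gapWord L ++ List.replicate a false) = (nonzeros L).length := by
  rw [countFactor_false_true_gapWord_append, countFactor_replicate, add_zero]

lemma fillWeight_closedCellWeight (m : ℕ) (g : List ℕ) :
    fillWeight (closedCellWeight p q t) m (gapWord g) =
      gapWeight (fun i j => q ^ i * p ^ j) (fun i j => t * q ^ i * p ^ j) m (nonzeros g) := by
  refine fillWeight_gapWord (fun L a b R => ?_) m g
  rw [closedCellWeight, countFactor_gapWord_append_replicate,
    countFactor_true_false_replicate_append, countFactor_true_false_gapWord]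
  cases b with
  | zero => simp; ring
  | succ b => simp [List.replicate_succ]

lemma fillWeight_openCellWeight (m : ℕ) (g : List ℕ) :
    fillWeight (openCellWeight p q t) m (gapWord g) =
      gapWeight (fun i j => q ^ i * p ^ j) (openWeight p q t) m (nonzeros g) := by
  refine fillWeight_gapWord (fun L a b R => ?_) m g
  have hR := countFactor_false_true_gapWord_append R []
  simp only [List.append_nil, countFactor, add_zero] at hR
  rw [openCellWeight, countFactor_gapWord_append_replicate,
    countFactor_false_true_replicate_append, hR]
  cases b with
  | zero => by_cases h : (nonzeros R).length = 0 <;> simp [openWeight, h]; ring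
  | succ b => simp [List.replicate_succ]

end FillWords

section Chains

variable {K : Type*} [CommRing K] {n : ℕ}

lemma cellSum_ofFn_append (f : List Bool → List Bool → K) (s : Fin n → Bool) (T : List Bool) :
    cellSum f (List.ofFn s ++ T) =
      ∑ x : Fin n, (if s x then 0 else
        f ((List.ofFn s).take x) ((List.ofFn s).drop (x + 1) ++ T)) +
        cellSum (fun u v => f (List.ofFn s ++ u) v) T := by
  induction n generalizing f with
  | zero => simp
  | succ n ih =>
    simp [List.ofFn_succ, cellSum, ih, Fin.sum_univ_succ, add_assoc]

/-- The word recording which positions lie in `S`. -/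
def memWord (S : Finset (Fin n)) : List Bool := List.ofFn fun i => decide (i ∈ S)

@[simp] lemma length_memWord (S : Finset (Fin n)) : (memWord S).length = n := by
  simp [memWord]

lemma take_append_true_cons_drop_memWord (S : Finset (Fin n)) (x : Fin n) :
    (memWord S).take x ++ true :: (memWord S).drop (x + 1) = memWord (insert x S) := by
  have hset : (memWord S).take x ++ true :: (memWord S).drop (x + 1) = (memWord S).set x true := by
    simp [List.set_eq_take_append_cons_drop]
  rw [hset]
  refine List.ext_getElem (by simp) fun i h1 h2 => ?_
  simp only [memWord, List.getElem_set, List.getElem_ofFn, Finset.mem_insert, Fin.ext_iff]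
  by_cases h : (x : ℕ) = i
  · simp [h]
  · simp [h, Ne.symm h]

/-- The weight of filling the position `x` when the positions in `S` are already filled. -/
def stepWeight (w : List Bool → List Bool → K) (T : List Bool) (S : Finset (Fin n))
    (x : Fin n) : K :=
  w ((memWord S).take x) ((memWord S).drop (x + 1) ++ T)

lemma sum_prod_stepWeight {w : List Bool → List Bool → K} {T : List Bool}
    (hT : ∀ u (F : List Bool → List Bool → K),
      cellSum (fun u' v => w (u ++ u') v * F u' v) T = 0) (m : ℕ) (S : Finset (Fin n)) :
    ∑ f : Fin m → Fin n, ∏ k, (if f k ∈ S ∪ (Finset.Iio k).image f then 0 else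
      stepWeight w T (S ∪ (Finset.Iio k).image f) (f k)) =
      fillWeight w m (memWord S ++ T) := by
  induction m generalizing S with
  | zero => simp [fillWeight]
  | succ m ih =>
    rw [fillWeight, memWord, cellSum_ofFn_append, hT, add_zero,
      ← (Fin.consEquiv fun _ => Fin n).sum_comp, Fintype.sum_prod_type]
    refine Finset.sum_congr rfl fun x _ => ?_
    have himage (f : Fin m → Fin n) (k : Fin m) :
        S ∪ (Finset.Iio k.succ).image (Fin.cons x f : Fin (m + 1) → Fin n) =
          insert x S ∪ (Finset.Iio k).image f := by
      ext y
      simp only [Finset.mem_union, Finset.mem_image, Finset.mem_Iio, Finset.mem_insert,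
        Fin.exists_fin_succ, Fin.cons_zero, Fin.cons_succ, Fin.succ_lt_succ_iff,
        Fin.succ_pos, true_and, eq_comm (a := y)]
      tauto
    have hcons (f : Fin m → Fin n) : (Fin.consEquiv fun _ => Fin n) (x, f) =
        (Fin.cons x f : Fin (m + 1) → Fin n) := rfl
    have h0 : Finset.Iio (0 : Fin (m + 1)) = ∅ := by ext; simp
    simp only [hcons, Fin.prod_univ_succ, Fin.cons_zero, Fin.cons_succ, himage, h0,
      Finset.image_empty, Finset.union_empty, decide_eq_true_eq]
    by_cases hx : x ∈ S
    · simp [hx]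
    · simp only [hx, if_false]
      rw [← Finset.mul_sum, ih, ← take_append_true_cons_drop_memWord]
      simp [stepWeight, memWord]

lemma sum_perm_prod_stepWeight {w : List Bool → List Bool → K} {T : List Bool}
    (hT : ∀ u (F : List Bool → List Bool → K),
      cellSum (fun u' v => w (u ++ u') v * F u' v) T = 0) :
    ∑ σ : Equiv.Perm (Fin n), ∏ x, stepWeight w T (Finset.univ.filter fun i => σ i < σ x) x =
      fillWeight w n (List.replicate n false ++ T) := by
  have h0 : memWord (∅ : Finset (Fin n)) = List.replicate n false := by
    simp [memWord]
  rw [← h0, ← sum_prod_stepWeight hT]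
  refine Finset.sum_of_injOn (fun σ => ⇑σ⁻¹) ?_ (by simp) ?_ ?_
  · intro σ _ τ _ h
    exact inv_injective (DFunLike.coe_injective h)
  · intro f _ hf
    have hinj : ¬ Function.Injective f := fun h => hf
      ⟨(Equiv.ofBijective f h.bijective_of_finite)⁻¹, by simp, by ext; simp⟩
    obtain ⟨i, j, hij, hne⟩ : ∃ i j, f i = f j ∧ i ≠ j := by
      simpa [Function.Injective] using hinj
    wlog hlt : i < j generalizing i j
    · exact this j i hij.symm hne.symm (lt_of_le_of_ne (not_lt.1 hlt) hne.symm)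
    refine Finset.prod_eq_zero (Finset.mem_univ j) (if_pos ?_)
    simp only [Finset.empty_union, Finset.mem_image, Finset.mem_Iio]
    exact ⟨i, hlt, hij⟩
  · intro σ _
    refine Fintype.prod_equiv σ _ _ fun x => ?_
    have h1 : (Finset.Iio (σ x)).image ⇑σ⁻¹ = Finset.univ.filter fun i => σ i < σ x := by
      ext i
      simp only [Finset.mem_image, Finset.mem_Iio, Finset.mem_filter, Finset.mem_univ, true_and]
      constructor
      · rintro ⟨a, ha, rfl⟩
        simpa using ha
      · exact fun h => ⟨σ i, h, by simp⟩
    rw [h1]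
    simp

end Chains

section Statistics

lemma countFactor_eq_card (a b : Bool) (l : List Bool) {N : ℕ} (hN : l.length ≤ N + 1) :
    countFactor a b l =
      ((Finset.range N).filter fun k => l[k]? = some a ∧ l[k + 1]? = some b).card := by
  induction l generalizing N with
  | nil => simp [countFactor]
  | cons x l ih =>
    cases l with
    | nil => simp [countFactor]
    | cons y l =>
      obtain ⟨N, rfl⟩ : ∃ M, N = M + 1 := ⟨N - 1, by simp at hN; omega⟩
      rw [countFactor, ih (N := N) (by simpa using hN), Finset.card_filter, Finset.card_filter,
        Finset.sum_range_succ', add_comm]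
      simp

lemma countFactor_take (a b : Bool) (l : List Bool) (m : ℕ) {N : ℕ} (hN : l.length ≤ N) :
    countFactor a b (l.take m) = ((Finset.range N).filter fun k =>
      k + 1 < m ∧ l[k]? = some a ∧ l[k + 1]? = some b).card := by
  rw [countFactor_eq_card a b _ (N := N) (by simp; omega)]
  congr 1
  ext k
  simp only [Finset.mem_filter, List.getElem?_take]
  by_cases h : k + 1 < m
  · simp [h, show k < m by omega]
  · simp [h]

lemma countFactor_drop (a b : Bool) (l : List Bool) (m : ℕ) {N : ℕ} (hN : l.length ≤ N) :
    countFactor a b (l.drop m) = ((Finset.range N).filter fun k =>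
      m ≤ k ∧ l[k]? = some a ∧ l[k + 1]? = some b).card := by
  rw [countFactor_eq_card a b _ (N := N) (by simp; omega)]
  refine Finset.card_nbij' (fun k => m + k) (fun k => k - m) ?_ ?_ ?_ ?_
  · intro k hk
    simp only [Finset.coe_filter, Finset.mem_range, List.getElem?_drop, Set.mem_ofPred_eq] at hk ⊢
    have := (List.getElem?_eq_some_iff.1 hk.2.1).1
    exact ⟨by omega, by omega, hk.2⟩
  · intro k hk
    simp only [Finset.coe_filter, Finset.mem_range, List.getElem?_drop, Set.mem_ofPred_eq] at hk ⊢
    rw [show m + (k - m) = k by omega, show m + (k - m + 1) = k + 1 by omega]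
    exact ⟨by omega, hk.2.2⟩
  · intro k _
    simp
  · intro k hk
    simp only [Finset.coe_filter, Set.mem_ofPred_eq] at hk
    exact Nat.add_sub_cancel' hk.2.1

lemma countFactor_append_false_true (l : List Bool) :
    countFactor false true (l ++ [false, true]) = countFactor false true l + 1 := by
  induction l with
  | nil => rfl
  | cons x l ih => cases l <;> cases x <;> simp_all [countFactor, add_assoc]

lemma countFactor_append_true (l : List Bool) :
    countFactor true false (l ++ [true]) = countFactor true false l := by
  induction l with
  | nil => rfl
  | cons x l ih => cases l <;> cases x <;> simp_all [countFactor]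

end Statistics

section PermStatistics

variable {n : ℕ} (σ : Equiv.Perm (Fin n))

lemma pval_succ (x : Fin n) : pval n σ (x + 1) = (σ x : ℕ) + 1 := by
  simp [pval]

lemma pval_inj {i j : ℕ} (hi : i < n) (hj : j < n) :
    pval n σ (i + 1) = pval n σ (j + 1) ↔ i = j := by
  rw [pval_succ σ ⟨i, hi⟩, pval_succ σ ⟨j, hj⟩, Nat.add_right_cancel_iff, ← Fin.ext_iff,
    σ.injective.eq_iff, Fin.mk.injEq]

/-- The positions of the values smaller than the one at `x`, as a word. -/
def smallerWord (x : Fin n) : List Bool := memWord (Finset.univ.filter fun i => σ i < σ x)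

@[simp] lemma length_smallerWord (x : Fin n) : (smallerWord σ x).length = n :=
  length_memWord _

lemma getElem?_smallerWord_true (x : Fin n) (j : ℕ) :
    (smallerWord σ x)[j]? = some true ↔ j < n ∧ pval n σ (j + 1) < pval n σ (x + 1) := by
  by_cases hj : j < n
  · simp [smallerWord, memWord, hj, pval_succ σ ⟨j, hj⟩, pval_succ σ x]
  · simp [smallerWord, memWord, hj]

lemma getElem?_smallerWord_false (x : Fin n) (j : ℕ) :
    (smallerWord σ x)[j]? = some false ↔ j < n ∧ pval n σ (x + 1) ≤ pval n σ (j + 1) := by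
  by_cases hj : j < n
  · simp [smallerWord, memWord, hj, pval_succ σ ⟨j, hj⟩, pval_succ σ x]
  · simp [smallerWord, memWord, hj]

lemma les_eq_sum_s6 :
    les n σ = ∑ x : Fin n, countFactor false true ((smallerWord σ x).take x) := by
  simp only [countFactor_take _ _ _ _ (length_smallerWord σ _).le, ← Finset.card_sigma,
    getElem?_smallerWord_true, getElem?_smallerWord_false]
  symm
  refine Finset.card_bij (fun y _ => (y.2 + 2, (y.1 : ℕ) + 1)) ?_ ?_ ?_
  · rintro ⟨x, k⟩ h
    simp only [Finset.mem_sigma, Finset.mem_univ, true_and, Finset.mem_filter, Finset.mem_range,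
      Finset.mem_product, Finset.mem_Icc] at h ⊢
    have := pval_inj σ h.2.2.1.1 x.2
    have := x.2
    simp only [show k + 2 - 1 = k + 1 by omega]
    exact ⟨by omega, by omega, by omega, h.2.2.2.2⟩
  · rintro ⟨x, k⟩ _ ⟨x', k'⟩ _ h
    simp only [Prod.mk.injEq, Nat.add_right_cancel_iff, ← Fin.ext_iff] at h
    obtain ⟨rfl, rfl⟩ := h
    rfl
  · rintro ⟨i, j⟩ h
    simp only [Finset.mem_filter, Finset.mem_product, Finset.mem_Icc] at h
    obtain ⟨⟨⟨hi, hi'⟩, hj, hj'⟩, hij, h1, h2⟩ := h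
    refine ⟨⟨⟨j - 1, by omega⟩, i - 2⟩, ?_, by simp; omega⟩
    simp only [Finset.mem_sigma, Finset.mem_univ, true_and, Finset.mem_filter, Finset.mem_range,
      show i - 2 + 1 = i - 1 by omega, show i - 1 + 1 = i by omega, show j - 1 + 1 = j by omega]
    omega

lemma ress_eq_sum_s6 :
    ress n σ = ∑ x : Fin n, countFactor false true ((smallerWord σ x).drop (x + 1)) := by
  simp only [countFactor_drop _ _ _ _ (length_smallerWord σ _).le, ← Finset.card_sigma,
    getElem?_smallerWord_true, getElem?_smallerWord_false]
  symm
  refine Finset.card_bij (fun y _ => ((y.1 : ℕ) + 1, y.2 + 1)) ?_ ?_ ?_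
  · rintro ⟨x, k⟩ h
    simp only [Finset.mem_sigma, Finset.mem_univ, true_and, Finset.mem_filter, Finset.mem_range,
      Finset.mem_product, Finset.mem_Icc] at h ⊢
    have := pval_inj σ h.2.2.1.1 x.2
    have := x.2
    omega
  · rintro ⟨x, k⟩ _ ⟨x', k'⟩ _ h
    simp only [Prod.mk.injEq, Nat.add_right_cancel_iff, ← Fin.ext_iff] at h
    obtain ⟨rfl, rfl⟩ := h
    rfl
  · rintro ⟨i, j⟩ h
    simp only [Finset.mem_filter, Finset.mem_product, Finset.mem_Icc] at h
    obtain ⟨⟨⟨hi, hi'⟩, hj, hj'⟩, hij, h1, h2⟩ := h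
    refine ⟨⟨⟨i - 1, by omega⟩, j - 1⟩, ?_, by simp; omega⟩
    simp only [Finset.mem_sigma, Finset.mem_univ, true_and, Finset.mem_filter, Finset.mem_range,
      show i - 1 + 1 = i by omega, show j - 1 + 1 = j by omega]
    omega

lemma res_eq_sum :
    res n σ = ∑ x : Fin n, countFactor true false ((smallerWord σ x).drop (x + 1)) := by
  simp only [countFactor_drop _ _ _ _ (length_smallerWord σ _).le, ← Finset.card_sigma,
    getElem?_smallerWord_true, getElem?_smallerWord_false]
  symm
  refine Finset.card_bij (fun y _ => ((y.1 : ℕ) + 1, y.2 + 1)) ?_ ?_ ?_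
  · rintro ⟨x, k⟩ h
    simp only [Finset.mem_sigma, Finset.mem_univ, true_and, Finset.mem_filter, Finset.mem_range,
      Finset.mem_product, Finset.mem_Icc] at h ⊢
    have := pval_inj σ h.2.2.2.1 x.2
    have := x.2
    omega
  · rintro ⟨x, k⟩ _ ⟨x', k'⟩ _ h
    simp only [Prod.mk.injEq, Nat.add_right_cancel_iff, ← Fin.ext_iff] at h
    obtain ⟨rfl, rfl⟩ := h
    rfl
  · rintro ⟨i, j⟩ h
    simp only [Finset.mem_filter, Finset.mem_product, Finset.mem_Icc] at h
    obtain ⟨⟨⟨hi, hi'⟩, hj, hj'⟩, hij, h1, h2⟩ := h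
    refine ⟨⟨⟨i - 1, by omega⟩, j - 1⟩, ?_, by simp; omega⟩
    simp only [Finset.mem_sigma, Finset.mem_univ, true_and, Finset.mem_filter, Finset.mem_range,
      show i - 1 + 1 = i by omega, show j - 1 + 1 = j by omega]
    omega

lemma head?_drop_smallerWord (x : Fin n) :
    ((smallerWord σ x).drop (x + 1)).head? = some true ↔
      (x : ℕ) + 1 < n ∧ pval n σ (x + 1 + 1) < pval n σ (x + 1) := by
  rw [List.head?_drop, getElem?_smallerWord_true]

lemma des_eq_card :
    des n σ = (Finset.univ.filter fun x : Fin n =>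
      ((smallerWord σ x).drop (x + 1)).head? = some true).card := by
  simp only [head?_drop_smallerWord]
  symm
  refine Finset.card_bij (fun x _ => (x : ℕ) + 1) ?_ ?_ ?_
  · intro x h
    simp only [Finset.mem_univ, true_and, Finset.mem_filter, Finset.mem_Icc] at h ⊢
    exact ⟨by omega, h.2⟩
  · intro x _ y _ h
    exact Fin.ext (Nat.add_right_cancel h)
  · intro i h
    simp only [Finset.mem_filter, Finset.mem_Icc] at h
    refine ⟨⟨i - 1, by omega⟩, ?_, by simp; omega⟩
    simp only [Finset.mem_univ, true_and, Finset.mem_filter, show i - 1 + 1 = i by omega]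
    exact ⟨by omega, h.2⟩

variable {K : Type*} [CommRing K] (p q t : K)

lemma prod_openCellWeight :
    ∏ x, stepWeight (openCellWeight p q t) [false, true]
      (Finset.univ.filter fun i => σ i < σ x) x =
      p ^ ress n σ * q ^ les n σ * t ^ des n σ := by
  have h (x : Fin n) : stepWeight (openCellWeight p q t) [false, true]
      (Finset.univ.filter fun i => σ i < σ x) x =
      p ^ countFactor false true ((smallerWord σ x).drop (x + 1)) *
        q ^ countFactor false true ((smallerWord σ x).take x) *
        (if ((smallerWord σ x).drop (x + 1)).head? = some true then t else 1) := by
    have hhead (l : List Bool) : (l ++ [false, true]).head? = some true ↔ l.head? = some true := by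
      cases l <;> simp
    change openCellWeight p q t ((smallerWord σ x).take x)
      ((smallerWord σ x).drop (x + 1) ++ [false, true]) = _
    simp only [openCellWeight, countFactor_append_false_true, hhead, Nat.add_sub_cancel,
      Nat.succ_ne_zero, if_false]
    ring
  rw [Finset.prod_congr rfl fun x _ => h x, Finset.prod_mul_distrib, Finset.prod_mul_distrib,
    Finset.prod_pow_eq_pow_sum, Finset.prod_pow_eq_pow_sum, ← ress_eq_sum_s6, ← les_eq_sum_s6,
    ← Finset.prod_filter, Finset.prod_const, ← des_eq_card]

lemma prod_closedCellWeight (hn : 0 < n) :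
    ∏ x, stepWeight (closedCellWeight p q t) [true]
      (Finset.univ.filter fun i => σ i < σ x) x =
      t * (p ^ res n σ * q ^ les n σ * t ^ des n σ) := by
  have h (x : Fin n) : stepWeight (closedCellWeight p q t) [true]
      (Finset.univ.filter fun i => σ i < σ x) x =
      p ^ countFactor true false ((smallerWord σ x).drop (x + 1)) *
        q ^ countFactor false true ((smallerWord σ x).take x) *
        (if ((smallerWord σ x).drop (x + 1)).head? = some true then t else 1) *
        (if x = ⟨n - 1, by omega⟩ then t else 1) := by
    change closedCellWeight p q t ((smallerWord σ x).take x)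
      ((smallerWord σ x).drop (x + 1) ++ [true]) = _
    have hlast : x = ⟨n - 1, by omega⟩ ↔ (smallerWord σ x).drop (x + 1) = [] := by
      have := x.2
      rw [List.drop_eq_nil_iff, length_smallerWord, Fin.ext_iff]
      simp only
      omega
    simp only [closedCellWeight, countFactor_append_true, hlast]
    rcases (smallerWord σ x).drop (x + 1) with _ | ⟨b, l⟩
    · simp [mul_comm]
    · cases b <;> simp [mul_comm]
  rw [Finset.prod_congr rfl fun x _ => h x, Finset.prod_mul_distrib, Finset.prod_mul_distrib,
    Finset.prod_mul_distrib, Finset.prod_pow_eq_pow_sum, Finset.prod_pow_eq_pow_sum,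
    ← res_eq_sum, ← les_eq_sum_s6, ← Finset.prod_filter, Finset.prod_const, ← des_eq_card,
    Fintype.prod_ite_eq', mul_comm]

lemma sum_ress_les_des :
    ∑ σ : Equiv.Perm (Fin n), p ^ ress n σ * q ^ les n σ * t ^ des n σ =
      gapWeight (fun i j => q ^ i * p ^ j) (openWeight p q t) n [n + 1] := by
  simp only [← prod_openCellWeight]
  rw [sum_perm_prod_stepWeight]
  · have := fillWeight_openCellWeight p q t n [n + 1]
    simpa [nonzeros, List.replicate_succ'] using this
  · simp [cellSum, openCellWeight, countFactor]

lemma mul_sum_res_les_des (hn : 0 < n) :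
    t * ∑ σ : Equiv.Perm (Fin n), p ^ res n σ * q ^ les n σ * t ^ des n σ =
      gapWeight (fun i j => q ^ i * p ^ j) (fun i j => t * q ^ i * p ^ j) n [n] := by
  simp only [Finset.mul_sum, ← prod_closedCellWeight _ _ _ _ hn]
  rw [sum_perm_prod_stepWeight]
  · have := fillWeight_closedCellWeight p q t n [n]
    simpa [nonzeros, hn.ne'] using this
  · simp [cellSum]

end PermStatistics

/-- The triples `(ress, les, des)` and `(res, les, des)` are
equidistributed on `S_n`. -/
theorem statement6 (n : ℕ) (hn : 0 < n) :
    (∑ σ : Equiv.Perm (Fin n),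
      (X 0 : MvPolynomial (Fin 3) ℤ) ^ (ress n σ) * (X 1) ^ (les n σ) * (X 2) ^ (des n σ)) =
    ∑ σ : Equiv.Perm (Fin n),
      (X 0 : MvPolynomial (Fin 3) ℤ) ^ (res n σ) * (X 1) ^ (les n σ) * (X 2) ^ (des n σ) := by
  refine mul_left_cancel₀ (X_ne_zero (2 : Fin 3)) ?_
  rw [sum_ress_les_des, mul_sum_res_les_des _ _ _ hn, gapWeight_closed_eq_mul_open _ _ _ n hn]
end

section
/- For every positive integer n and every permutation σ ∈ S_n, one has inv σ = drop σ + cros σ + 2·nest σ. -/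
open Finset MvPolynomial

/-- Reindexing by an injective self-map of a finite set does not change a sum. -/
theorem sum_comp_of_mapsTo_injOn {α M : Type*} [AddCommMonoid M] {s : Finset α}
    {a : α → α} (hm : ∀ i ∈ s, a i ∈ s) (hi : Set.InjOn a s) (f : α → M) :
    ∑ i ∈ s, f (a i) = ∑ i ∈ s, f i :=
  Finset.sum_nbij a hm hi (Finset.surjOn_of_injOn_of_card_le a hm hi le_rfl) fun _ _ => rfl

/-- The contribution of the ordered pair `(i, j)`, with values `p` and `q`, to
`inv - drop - cros - 2 * nest`; the diagonal carries the drops. -/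
def pairDefect (i j p q : ℕ) : ℤ :=
  (if i < j ∧ q < p then 1 else 0) - (if i = j then if p < i then 1 else 0 else 0)
    - (if (i < j ∧ j ≤ p ∧ p < q) ∨ (j < i ∧ p < j ∧ q < p) then 1 else 0)
    - 2 * (if (i < j ∧ j ≤ q ∧ q < p) ∨ (j < i ∧ q < j ∧ p < q) then 1 else 0)

/-- A summand equivalent to `pairDefect` up to symmetrization, whose sum over `j` vanishes. -/
def pairBalance (i j p q : ℕ) : ℤ :=
  if i ≤ p then (if q ≤ p then 1 else 0) - (if j ≤ p then 1 else 0)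
  else (if j < i then 1 else 0) - (if q < i then 1 else 0)

theorem pairDefect_add_swap {i j p q : ℕ} (h : i = j ↔ p = q) :
    pairDefect i j p q + pairDefect j i q p = pairBalance i j p q + pairBalance j i q p := by
  have hij : i = j ↔ ¬ i < j ∧ ¬ j < i := by omega
  have hji : j = i ↔ ¬ i < j ∧ ¬ j < i := by omega
  simp only [pairDefect, pairBalance, ← not_lt, hij, hji]
  by_cases h1 : i < j <;> by_cases h2 : j < i <;> by_cases h3 : p < q <;>
    by_cases h4 : q < p <;> try (exfalso; omega)
  all_goals
    by_cases h5 : p < i <;> by_cases h6 : q < j <;> by_cases h7 : p < j <;>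
      by_cases h8 : q < i <;>
      first
      | (exfalso; omega)
      | simp [h1, h2, h3, h4, h5, h6, h7, h8]

theorem sum_pairDefect_eq_zero {s : Finset ℕ} {a : ℕ → ℕ} (hm : ∀ i ∈ s, a i ∈ s)
    (hi : Set.InjOn a s) : ∑ i ∈ s, ∑ j ∈ s, pairDefect i j (a i) (a j) = 0 := by
  have balance : ∑ i ∈ s, ∑ j ∈ s, pairBalance i j (a i) (a j) = 0 := by
    refine Finset.sum_eq_zero fun i _ => ?_
    unfold pairBalance
    split_ifs
    · rw [Finset.sum_sub_distrib, sub_eq_zero]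
      exact sum_comp_of_mapsTo_injOn hm hi fun j => if j ≤ a i then (1 : ℤ) else 0
    · rw [Finset.sum_sub_distrib, sub_eq_zero]
      exact (sum_comp_of_mapsTo_injOn hm hi fun j => if j < i then (1 : ℤ) else 0).symm
  have symmetrized : ∑ i ∈ s, ∑ j ∈ s, (pairDefect i j (a i) (a j) + pairDefect j i (a j) (a i)) =
      ∑ i ∈ s, ∑ j ∈ s, (pairBalance i j (a i) (a j) + pairBalance j i (a j) (a i)) :=
    Finset.sum_congr rfl fun i hi' => Finset.sum_congr rfl fun j hj' =>
      pairDefect_add_swap ⟨fun h => congrArg a h, fun h => hi hi' hj' h⟩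
  simp only [Finset.sum_add_distrib] at symmetrized
  rw [Finset.sum_comm (f := fun i j => pairDefect j i (a j) (a i)),
    Finset.sum_comm (f := fun i j => pairBalance j i (a j) (a i)), balance] at symmetrized
  omega

theorem pval_mem_Icc {n : ℕ} (σ : Equiv.Perm (Fin n)) {i : ℕ} (hi : i ∈ Finset.Icc 1 n) :
    pval n σ i ∈ Finset.Icc 1 n := by
  rw [pval, dif_pos (Finset.mem_Icc.1 hi), Finset.mem_Icc]
  omega

theorem pval_injOn {n : ℕ} (σ : Equiv.Perm (Fin n)) :
    Set.InjOn (pval n σ) (Finset.Icc 1 n : Finset ℕ) := by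
  intro i hi j hj h
  have hi' := Finset.mem_Icc.1 hi
  have hj' := Finset.mem_Icc.1 hj
  rw [pval, pval, dif_pos hi', dif_pos hj', add_left_inj, Fin.val_inj,
    σ.injective.eq_iff, Fin.mk.injEq] at h
  omega

/-- For every `σ ∈ S_n`, `inv σ = drop σ + cros σ + 2·nest σ`. -/
theorem statement7 (n : ℕ) (hn : 0 < n) (σ : Equiv.Perm (Fin n)) :
    inv n σ = drp n σ + cros n σ + 2 * nest n σ := by
  have key := sum_pairDefect_eq_zero (fun i hi => pval_mem_Icc σ hi) (pval_injOn σ)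
  have drops : ∑ i ∈ Finset.Icc 1 n, ∑ j ∈ Finset.Icc 1 n,
      (if i = j then if pval n σ i < i then (1 : ℤ) else 0 else 0) =
      ∑ i ∈ Finset.Icc 1 n, if pval n σ i < i then (1 : ℤ) else 0 :=
    Finset.sum_congr rfl fun i hi => by rw [Finset.sum_ite_eq, if_pos hi]
  simp only [pairDefect, Finset.sum_sub_distrib, ← Finset.mul_sum, drops] at key
  zify
  simp only [inv, drp, cros, nest, Finset.card_filter, Finset.sum_product, Nat.cast_sum,
    Nat.cast_ite, Nat.cast_one, Nat.cast_zero]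
  linarith
end
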